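/- arXiv:2507.16694 — 4 statements merged into one kernel-verified Lean document; each statement's English description precedes it below -/
import Mathlib

section
/- Let σ be a field automorphism of F_q with σ ≠ id and let s be the order of the fixed subfield of σ. For every nonzero (n+1)×(n+1) matrix M over F_q of rank r (1 ≤ r ≤ n+1), one has θ_M ≤ (q^{n+1−r}−1)/(q−1) + (s^r−1)/(s−1). -/
open Matrix

/-- `theta σ M` : the number of projective points `[ξ]` (ξ a nonzero row vector) such that
`ξ·M = λ·ξ^σ` for some `λ ∈ F`. -/
noncomputable def theta {F : Type} [Field F] [Fintype F] {n : ℕ}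
    (σ : F ≃+* F) (M : Matrix (Fin (n + 1)) (Fin (n + 1)) F) : ℕ :=
  Nat.card {ξ : Projectivization F (Fin (n + 1) → F) //
    ∃ l : F, ξ.rep ᵥ* M = l • (fun i => σ (ξ.rep i))}

/-- The solutions `c` of `c * a = b * σ c` are at most as many as the fixed points of `σ`. -/
lemma card_twisted_fixed_le {F : Type*} [Field F] [Fintype F] [DecidableEq F] (σ : F ≃+* F)
    {a b : F} (hb : b ≠ 0) :
    (Finset.univ.filter fun c : F => c * a = b * σ c).card ≤ Nat.card {a : F // σ a = a} := by
  rw [Nat.subtype_card (Finset.univ.filter fun c : F => σ c = c) (by simp)]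
  by_cases h : ∃ d : F, d ≠ 0 ∧ d * a = b * σ d
  · obtain ⟨d, hd, hda⟩ := h
    refine Finset.card_le_card_of_injOn (fun c => c / d) ?_ ?_
    · intro c hc
      simp only [Finset.coe_filter, Finset.mem_univ, true_and, Set.mem_ofPred_eq] at hc ⊢
      have hσd : σ d ≠ 0 := by simpa using hd
      rw [map_div₀, div_eq_div_iff hσd hd]
      apply mul_left_cancel₀ hb
      linear_combination (-d) * hc + c * hda
    · intro c _ c' _ h
      exact (div_left_inj' hd).1 h
  · push Not at h
    refine Finset.card_le_card fun c hc => ?_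
    simp only [Finset.mem_filter, Finset.mem_univ, true_and] at hc ⊢
    have : c = 0 := by
      by_contra h0
      exact h c h0 hc
    simp [this]

/-- Tuples with first nonzero coordinate `1`, say at position `i`, whose remaining coordinates
satisfy `c j * μ j = μ i * σ (c j)`. -/
def normalizedEigentuples {F : Type*} [Field F] [Fintype F] [DecidableEq F] (σ : F ≃+* F)
    {d : ℕ} (μ : Fin d → F) : Finset (Fin d → F) :=
  Finset.univ.biUnion fun i => Fintype.piFinset fun j =>
    if j < i then {0} else if j = i then {1} else
      Finset.univ.filter fun c : F => c * μ j = μ i * σ c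

lemma card_normalizedEigentuples_le {F : Type*} [Field F] [Fintype F] [DecidableEq F]
    (σ : F ≃+* F) {d : ℕ} (μ : Fin d → F) (hμ : ∀ i, μ i ≠ 0) :
    (normalizedEigentuples σ μ).card ≤
      ∑ i ∈ Finset.range d, Nat.card {a : F // σ a = a} ^ i := by
  set s := Nat.card {a : F // σ a = a}
  calc (normalizedEigentuples σ μ).card
      ≤ ∑ i : Fin d, s ^ (d - 1 - (i : ℕ)) := by
        refine Finset.card_biUnion_le.trans (Finset.sum_le_sum fun i _ => ?_)
        rw [Fintype.card_piFinset]
        calc _ ≤ ∏ j : Fin d, (if j ∈ Finset.Ioi i then s else 1) := by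
              refine Finset.prod_le_prod' fun j _ => ?_
              rcases lt_trichotomy j i with h | h | h
              · simp [h, h.le.not_gt]
              · simp [h]
              · simpa only [h.not_gt, h.ne', Finset.mem_Ioi, h, if_true, if_false] using
                  card_twisted_fixed_le σ (hμ i)
          _ = s ^ (d - 1 - (i : ℕ)) := by
              rw [Finset.prod_ite_mem, Finset.univ_inter, Finset.prod_const, Fin.card_Ioi]
    _ = ∑ i ∈ Finset.range d, s ^ i := by
        rw [Fin.sum_univ_eq_sum_range (fun i => s ^ (d - 1 - i)) d, Finset.sum_range_reflect]

/-- The coordinatewise images of a linearly independent family under a field automorphism are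
linearly independent. -/
lemma LinearIndependent.comp_ringEquiv {F ι κ : Type*} [Field F] (σ : F ≃+* F)
    {v : ι → κ → F} (hv : LinearIndependent F v) :
    LinearIndependent F fun i k => σ (v i k) := by
  refine hv.map_of_injective_injective (σ.symm : F → F)
    (AddMonoidHom.compLeft (σ : F →+ F) κ) (by simp) ?_ ?_
  · intro m hm
    ext k
    simpa using congrFun hm k
  · intro r m
    ext k
    simp

lemma card_twisted_eigenpoints_le {F κ : Type*} [Field F] [Fintype F] [Fintype κ] (σ : F ≃+* F)
    (M : Matrix κ κ F) :
    Nat.card {ξ : Projectivization F (κ → F) //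
      ∃ l : F, l ≠ 0 ∧ ξ.rep ᵥ* M = l • (fun i => σ (ξ.rep i))} ≤
      ∑ i ∈ Finset.range M.rank, Nat.card {a : F // σ a = a} ^ i := by
  classical
  set E : Set (κ → F) := {x | ∃ l : F, l ≠ 0 ∧ x ᵥ* M = l • (fun i => σ (x i))}
  obtain ⟨b, hbE, hspan, hli⟩ := exists_linearIndependent F E
  have : Fintype b := Fintype.ofFinite b
  let e := Fintype.equivFin b
  set d := Fintype.card b
  let v : Fin d → κ → F := fun i => (e.symm i : κ → F)
  have hv : LinearIndependent F v := hli.comp _ e.symm.injective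
  have hrange : Set.range v = b := by
    exact (e.symm.surjective.range_comp (Subtype.val : b → κ → F)).trans Subtype.range_coe
  have hvE : ∀ i, ∃ l : F, l ≠ 0 ∧ v i ᵥ* M = l • (fun k => σ (v i k)) :=
    fun i => hbE (e.symm i).2
  choose μ hμ hvM using hvE
  have hσv := hv.comp_ringEquiv σ
  have hd : d ≤ M.rank := by
    have hmem : ∀ i, (fun k => σ (v i k)) ∈ LinearMap.range (Mᵀ).mulVecLin := by
      refine fun i => ⟨(μ i)⁻¹ • v i, ?_⟩
      rw [mulVecLin_apply, mulVec_smul, mulVec_transpose, hvM, inv_smul_smul₀ (hμ i)]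
    have hli' : LinearIndependent F
        (fun i => (⟨_, hmem i⟩ : LinearMap.range (Mᵀ).mulVecLin)) :=
      LinearIndependent.of_comp (LinearMap.range (Mᵀ).mulVecLin).subtype hσv
    rw [← Matrix.rank_transpose M, Matrix.rank]
    simpa only [Fintype.card_fin] using hli'.fintype_card_le_finrank
  have key : ∀ p : {ξ : Projectivization F (κ → F) //
      ∃ l : F, l ≠ 0 ∧ ξ.rep ᵥ* M = l • (fun i => σ (ξ.rep i))},
      ∃ c ∈ normalizedEigentuples σ μ, ∃ a : F, a • (∑ i, c i • v i) = p.1.rep := by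
    rintro ⟨p, l, hl, hp⟩
    have hpE : p.rep ∈ Submodule.span F (Set.range v) := by
      rw [hrange, hspan]
      exact Submodule.subset_span ⟨l, hl, hp⟩
    obtain ⟨c, hc⟩ := (Submodule.mem_span_range_iff_exists_fun F).1 hpE
    have hcμ : ∀ i, c i * μ i = l * σ (c i) := by
      have h1 : ∑ i, (c i * μ i - l * σ (c i)) • (fun k => σ (v i k)) = 0 := by
        have h2 : p.rep ᵥ* M = ∑ i, (c i * μ i) • (fun k => σ (v i k)) := by
          rw [← hc, Matrix.sum_vecMul]
          exact Finset.sum_congr rfl fun i _ => by rw [smul_vecMul, hvM, smul_smul]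
        have h3 : (fun i => σ (p.rep i)) = ∑ i, σ (c i) • (fun k => σ (v i k)) := by
          rw [← hc]
          ext k
          simp [Finset.sum_apply]
        simp only [sub_smul, Finset.sum_sub_distrib, mul_smul l, ← Finset.smul_sum]
        rw [← h2, ← h3, hp, sub_self]
      exact fun i => sub_eq_zero.1 (Fintype.linearIndependent_iff.1 hσv _ h1 i)
    have hne : (Finset.univ.filter fun i => c i ≠ 0).Nonempty := by
      by_contra h
      rw [Finset.not_nonempty_iff_eq_empty, Finset.filter_eq_empty_iff] at h
      apply p.rep_nonzero
      rw [← hc]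
      exact Finset.sum_eq_zero fun i hi => by simp [not_not.1 (h hi)]
    obtain ⟨i, hi, hmin⟩ := Finset.exists_minimal hne
    have hi0 : c i ≠ 0 := (Finset.mem_filter.1 hi).2
    have hσi0 : σ (c i) ≠ 0 := by simpa using hi0
    refine ⟨fun j => c j / c i, ?_, c i, ?_⟩
    · simp only [normalizedEigentuples, Finset.mem_biUnion, Finset.mem_univ, true_and,
        Fintype.mem_piFinset]
      refine ⟨i, fun j => ?_⟩
      split_ifs with h1 h2
      · have : c j = 0 := by
          by_contra h0
          exact (hmin (by simpa using h0) h1.le).not_gt h1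
        simp [this]
      · simp [h2, hi0]
      · simp only [Finset.mem_filter, Finset.mem_univ, true_and, map_div₀]
        field_simp
        apply mul_left_cancel₀ hl
        linear_combination c i * μ i * hcμ j - c j * μ j * hcμ i
    · rw [← hc, Finset.smul_sum]
      exact Finset.sum_congr rfl fun j _ => by rw [smul_smul, mul_div_cancel₀ _ hi0]
  choose f hf g hg using key
  calc _ ≤ Nat.card (normalizedEigentuples σ μ) := by
        refine Nat.card_le_card_of_injective (fun p => ⟨f p, hf p⟩) fun p p' h => ?_
        have hfe : f p = f p' := congrArg Subtype.val h
        apply Subtype.ext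
        rw [← p.1.mk_rep, ← p'.1.mk_rep, Projectivization.mk_eq_mk_iff']
        have hg0 : g p' ≠ 0 := by
          intro h0
          apply p'.1.rep_nonzero
          rw [← hg p', h0, zero_smul]
        refine ⟨g p / g p', ?_⟩
        rw [← hg p, ← hg p', hfe, smul_smul, div_mul_cancel₀ _ hg0]
    _ = (normalizedEigentuples σ μ).card := by simp
    _ ≤ ∑ i ∈ Finset.range d, Nat.card {a : F // σ a = a} ^ i :=
        card_normalizedEigentuples_le σ μ hμ
    _ ≤ _ := Finset.sum_le_sum_of_subset (Finset.range_mono hd)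

lemma card_projective_ker_le {F κ : Type*} [Field F] [Fintype F] [Fintype κ]
    (M : Matrix κ κ F) :
    Nat.card {ξ : Projectivization F (κ → F) // ξ.rep ᵥ* M = 0} ≤
      ∑ i ∈ Finset.range (Fintype.card κ - M.rank), Fintype.card F ^ i := by
  classical
  have hk : Module.finrank F (LinearMap.ker (Mᵀ).mulVecLin) = Fintype.card κ - M.rank := by
    have := LinearMap.finrank_range_add_finrank_ker (Mᵀ).mulVecLin
    rw [Module.finrank_fintype_fun_eq_card] at this
    rw [← Matrix.rank_transpose M, Matrix.rank]
    omega
  rw [← Nat.card_eq_fintype_card (α := F), ← Projectivization.card_of_finrank F _ hk]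
  have hmem : ∀ p : {ξ : Projectivization F (κ → F) // ξ.rep ᵥ* M = 0},
      p.1.rep ∈ LinearMap.ker (Mᵀ).mulVecLin := fun p => by
    simpa [mulVec_transpose] using p.2
  refine Nat.card_le_card_of_injective
    (fun p => Projectivization.mk F (⟨p.1.rep, hmem p⟩ : LinearMap.ker (Mᵀ).mulVecLin)
      fun h => p.1.rep_nonzero (congrArg Subtype.val h)) fun p p' h => ?_
  obtain ⟨a, ha⟩ := (Projectivization.mk_eq_mk_iff' F _ _ _ _).1 h
  apply Subtype.ext
  rw [← p.1.mk_rep, ← p'.1.mk_rep, Projectivization.mk_eq_mk_iff']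
  exact ⟨a, congrArg Subtype.val ha⟩

theorem stmt_8 (F : Type) [Field F] [Fintype F] (n : ℕ) (hn : 2 ≤ n)
    (σ : F ≃+* F) (hσ : σ ≠ RingEquiv.refl F)
    (s : ℕ) (hs : s = Nat.card {a : F // σ a = a})
    (M : Matrix (Fin (n + 1)) (Fin (n + 1)) F) (hM : M ≠ 0)
    (r : ℕ) (hr : M.rank = r) (hr1 : 1 ≤ r) (hr2 : r ≤ n + 1) :
    theta σ M ≤ ((Fintype.card F) ^ (n + 1 - r) - 1) / ((Fintype.card F) - 1)
      + (s ^ r - 1) / (s - 1) := by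
  have hs2 : 2 ≤ s := by
    have : Nontrivial {a : F // σ a = a} :=
      ⟨⟨0, map_zero σ⟩, ⟨1, map_one σ⟩, fun h => zero_ne_one (congrArg Subtype.val h)⟩
    rw [hs]
    exact Finite.one_lt_card
  rw [← Nat.geomSum_eq hs2, ← Nat.geomSum_eq (Fintype.one_lt_card (α := F))]
  have hker := card_projective_ker_le M
  have heig := card_twisted_eigenpoints_le σ M
  rw [hr, Fintype.card_fin] at hker
  rw [hr, ← hs] at heig
  refine le_trans ?_ (add_le_add hker heig)
  classical
  have : Fintype (Projectivization F (Fin (n + 1) → F)) := Fintype.ofFinite _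
  simp only [theta, Nat.card_eq_fintype_card]
  refine le_trans (Fintype.card_subtype_mono _ _ ?_) (Fintype.card_subtype_or _ _)
  rintro ξ ⟨l, hl⟩
  by_cases h0 : l = 0
  · left
    simpa [h0] using hl
  · exact Or.inr ⟨l, h0, hl⟩
end

section
/- Let σ be a field automorphism of F_q with σ ≠ id and let s be the order of the fixed subfield of σ. Then the maximum of θ_M over all nonzero (n+1)×(n+1) matrices M over F_q equals s²+s+1 if σ² = id and n = 2 (so q = s²), and equals (q^n−1)/(q−1) + 1 if σ² ≠ id or n > 2. -/
open Matrix

open Finset in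
/-- A twisted one-dimensional eigen-equation has at most as many solutions as `σ` has fixed
points. -/
lemma card_twisted_solutions_le {F : Type} [Field F] [Fintype F] [DecidableEq F] (σ : F ≃+* F)
    (m l : F) (hm : m ≠ 0) :
    #{y : F | y * m = l * σ y} ≤ Nat.card {a : F // σ a = a} := by
  rw [Nat.card_eq_fintype_card, Fintype.card_subtype]
  by_cases h : ∃ z : F, z ≠ 0 ∧ z * m = l * σ z
  · obtain ⟨z, hz, hzm⟩ := h
    have hσz : σ z ≠ 0 := by simpa using hz
    have hl : l ≠ 0 := by
      rintro rfl
      simp_all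
    refine card_le_card_of_injOn (fun y => y / z) ?_ ?_
    · intro y hy
      simp only [coe_filter, mem_univ, true_and, Set.mem_ofPred_eq] at hy ⊢
      rw [map_div₀, div_eq_div_iff hσz hz]
      apply mul_left_cancel₀ (mul_ne_zero hl hm)
      linear_combination m * y * hzm - m * z * hy
    · intro a _ b _ hab
      exact (div_left_inj' hz).1 hab
  · push Not at h
    refine card_le_card_of_injOn id ?_ Function.injective_id.injOn
    intro y hy
    simp only [coe_filter, mem_univ, true_and, Set.mem_ofPred_eq, id] at hy ⊢
    by_cases hy0 : y = 0
    · simp [hy0]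
    · exact absurd hy (h y hy0)

open Finset in
/-- Upper bound for the number of nonzero vectors that a diagonal matrix `m` maps into the line of
their `σ`-conjugate. -/
lemma card_diagonal_eigenvectors_le {F : Type} [Field F] [Fintype F] [DecidableEq F]
    (σ : F ≃+* F) (r : ℕ) (m : Fin r → F) (hm : ∀ i, m i ≠ 0) :
    #{x : Fin r → F | x ≠ 0 ∧ ∃ l : F, ∀ i, x i * m i = l * σ (x i)} ≤
      (Fintype.card F - 1) * ∑ j ∈ range r, Nat.card {a : F // σ a = a} ^ j := by
  classical
  induction r with
  | zero =>
    rw [range_zero, sum_empty, mul_zero, Nat.le_zero, card_eq_zero, filter_eq_empty_iff]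
    exact fun x _ h => h.1 (Subsingleton.elim _ _)
  | succ r ih =>
    set s := Nat.card {a : F // σ a = a}
    set A : Finset (Fin r → F) :=
      {x | x ≠ 0 ∧ ∃ l : F, ∀ i, x i * m i.succ = l * σ (x i)} with hA
    let S : F → Fin r → Finset F := fun l i => {y | y * m i.succ = l * σ y}
    have hsub : ({x : Fin (r + 1) → F | x ≠ 0 ∧ ∃ l : F, ∀ i, x i * m i = l * σ (x i)} :
        Finset _) ⊆ A.image (fun y => (Fin.cons 0 y : Fin (r + 1) → F)) ∪
        (univ : Finset Fˣ).biUnion fun c =>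
          (Fintype.piFinset (S (c * m 0 / σ c))).image
            (fun y => (Fin.cons (c : F) y : Fin (r + 1) → F)) := by
      intro x hx
      simp only [mem_filter, mem_univ, true_and] at hx
      obtain ⟨hx0, l, hl⟩ := hx
      rw [mem_union]
      by_cases h0 : x 0 = 0
      · left
        refine mem_image.2 ⟨Fin.tail x, ?_, ?_⟩
        · simp only [hA, mem_filter, mem_univ, true_and]
          refine ⟨fun h => hx0 ?_, l, fun i => hl i.succ⟩
          rw [← Fin.cons_self_tail x, h, h0]
          ext i
          refine Fin.cases ?_ (fun _ => ?_) i <;> simp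
        · rw [← h0]
          exact Fin.cons_self_tail x
      · right
        refine mem_biUnion.2 ⟨Units.mk0 _ h0, mem_univ _, mem_image.2 ⟨Fin.tail x, ?_, ?_⟩⟩
        · rw [Fintype.mem_piFinset]
          intro i
          simp only [S, mem_filter, mem_univ, true_and, Units.val_mk0, Fin.tail]
          rw [hl 0, mul_div_assoc, div_self (by simpa using h0), mul_one, hl]
        · exact Fin.cons_self_tail x
    have hpi : ∀ c : F, #(Fintype.piFinset (S c)) ≤ s ^ r := fun c => by
      rw [Fintype.card_piFinset]
      refine (prod_le_pow_card _ _ s fun i _ => ?_).trans_eq (by simp)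
      exact card_twisted_solutions_le σ _ _ (hm _)
    calc _ ≤ _ := card_le_card hsub
      _ ≤ _ := card_union_le _ _
      _ ≤ (Fintype.card F - 1) * ∑ j ∈ range r, s ^ j + (Fintype.card F - 1) * s ^ r := by
        refine Nat.add_le_add (card_image_le.trans (ih _ fun i => hm _)) ?_
        refine (card_biUnion_le_card_mul _ _ (s ^ r) fun c _ =>
          card_image_le.trans (hpi _)).trans_eq ?_
        rw [card_univ, Fintype.card_units]
      _ = _ := by rw [sum_range_succ, mul_add]

/-- Each projective point counted by `theta` carries `|F| - 1` nonzero vectors. -/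
lemma theta_mul_card_sub_one {F : Type} [Field F] [Fintype F] {n : ℕ}
    (σ : F ≃+* F) (M : Matrix (Fin (n + 1)) (Fin (n + 1)) F) :
    theta σ M * (Fintype.card F - 1) =
      Nat.card {v : Fin (n + 1) → F // v ≠ 0 ∧ ∃ l : F, v ᵥ* M = l • (fun i => σ (v i))} := by
  classical
  have hscale : ∀ (u : Fˣ) (v : Fin (n + 1) → F),
      (∃ l : F, v ᵥ* M = l • (fun i => σ (v i))) →
      ∃ l : F, (u • v) ᵥ* M = l • (fun i => σ ((u • v) i)) := by
    rintro u v ⟨l, hl⟩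
    refine ⟨u * l / σ u, ?_⟩
    have hu : σ (u : F) ≠ 0 := by simp
    rw [Units.smul_def, Matrix.smul_vecMul, hl]
    ext i
    simp only [Pi.smul_apply, smul_eq_mul, map_mul]
    field_simp
  rw [← Fintype.card_units, ← Nat.card_eq_fintype_card, theta, ← Nat.card_prod]
  refine Nat.card_congr (Equiv.ofBijective (fun p =>
    ⟨p.2 • p.1.1.rep, ?_, hscale p.2 _ p.1.2⟩) ⟨?_, ?_⟩)
  · exact (smul_ne_zero_iff_ne _).2 p.1.1.rep_nonzero
  · rintro ⟨⟨p, hp⟩, u⟩ ⟨⟨p', hp'⟩, u'⟩ h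
    simp only [Subtype.mk.injEq] at h
    have hpp : p = p' := by
      rw [← p.mk_rep, ← p'.mk_rep, Projectivization.mk_eq_mk_iff]
      exact ⟨u⁻¹ * u', by rw [mul_smul, ← h, inv_smul_smul]⟩
    subst hpp
    have : (u : F) = u' := smul_left_injective F p.rep_nonzero h
    rw [Units.ext this]
  · rintro ⟨v, hv, hl⟩
    obtain ⟨a, ha⟩ := Projectivization.exists_smul_eq_mk_rep F v hv
    refine ⟨⟨⟨Projectivization.mk F v hv, ?_⟩, a⁻¹⟩, ?_⟩
    · rw [← ha]
      exact hscale a v hl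
    · simp [← ha]

/-- The main upper bound: `theta` is at most the number of points of a projective space over `F`
(the kernel of `M`) plus that of a projective space over the fixed field of `σ`. -/
lemma exists_theta_le {F : Type} [Field F] [Fintype F] {n : ℕ}
    (σ : F ≃+* F) (M : Matrix (Fin (n + 1)) (Fin (n + 1)) F) (hM : M ≠ 0) :
    ∃ k r : ℕ, k ≤ n ∧ r + k ≤ n + 1 ∧
      theta σ M ≤ ∑ i ∈ Finset.range k, Fintype.card F ^ i +
        ∑ j ∈ Finset.range r, Nat.card {a : F // σ a = a} ^ j := by
  classical
  set q := Fintype.card F with hq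
  have hq1 : 1 < q := Fintype.one_lt_card
  let L : (Fin (n + 1) → F) →ₗ[F] (Fin (n + 1) → F) := M.vecMulLinear
  let c : (Fin (n + 1) → F) → (Fin (n + 1) → F) := fun v i => σ (v i)
  let E : Set (Fin (n + 1) → F) := {v | ∃ l : F, l ≠ 0 ∧ v ᵥ* M = l • c v}
  obtain ⟨b, hbE, hspan, hli⟩ := exists_linearIndependent F E
  have : Finite b := Subtype.finite
  obtain ⟨r, ⟨f⟩⟩ := Finite.exists_equiv_fin b
  let e : Fin r → Fin (n + 1) → F := fun i => (f.symm i : Fin (n + 1) → F)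
  have he : LinearIndependent F e := hli.comp _ f.symm.injective
  have herange : Set.range e = b := by
    rw [show e = Subtype.val ∘ f.symm from rfl, f.symm.surjective.range_comp, Subtype.range_coe]
  choose m hm hme using fun i => hbE (f.symm i).2
  replace hme : ∀ i, L (e i) = m i • c (e i) := hme
  have hcsum : ∀ x : Fin r → F, c (∑ i, x i • e i) = ∑ i, σ (x i) • c (e i) := fun x => by
    ext j
    simp [c, Finset.sum_apply]
  have hce : LinearIndependent F (fun i => c (e i)) := by
    rw [Fintype.linearIndependent_iff] at he ⊢
    intro g hg i
    have h := hcsum fun i => σ.symm (g i)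
    simp only [RingEquiv.apply_symm_apply] at h
    rw [hg] at h
    have h0 : ∑ i, σ.symm (g i) • e i = 0 := by
      ext j
      have := congrFun h j
      exact (map_eq_zero σ).1 this
    simpa using he _ h0 i
  have hLsum : ∀ x : Fin r → F, L (∑ i, x i • e i) = ∑ i, (x i * m i) • c (e i) := fun x => by
    simp only [map_sum, map_smul, hme, mul_smul]
  have hLe : LinearIndependent F (fun i => L (e i)) := by
    rw [Fintype.linearIndependent_iff] at hce ⊢
    intro g hg i
    have := hce (fun i => g i * m i) (by simpa only [hme, mul_smul] using hg) i
    exact (mul_eq_zero.1 this).resolve_right (hm i)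
  set k := Module.finrank F (LinearMap.ker L) with hk
  have hrank : Module.finrank F (LinearMap.range L) + k = n + 1 := by
    rw [hk, LinearMap.finrank_range_add_finrank_ker]
    simp
  have hr : r ≤ Module.finrank F (LinearMap.range L) := by
    have h1 := finrank_span_eq_card hLe
    rw [Fintype.card_fin] at h1
    rw [← h1]
    apply Submodule.finrank_mono
    rw [Submodule.span_le]
    rintro _ ⟨i, rfl⟩
    exact ⟨_, rfl⟩
  have hL0 : L ≠ 0 := fun h => hM <| by
    ext i j
    have hi : Pi.single i 1 ᵥ* M = 0 := LinearMap.congr_fun h _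
    simpa using congrFun hi j
  have hkn : k ≤ n := by
    have : Module.finrank F (LinearMap.range L) ≠ 0 := by
      rw [Ne, Submodule.finrank_eq_zero, LinearMap.range_eq_bot]
      exact hL0
    omega
  refine ⟨k, r, hkn, by omega, ?_⟩
  have hq0 : 0 < q - 1 := by omega
  refine Nat.le_of_mul_le_mul_right ?_ hq0
  rw [theta_mul_card_sub_one, Nat.card_eq_fintype_card, Fintype.card_subtype]
  have hsub : ({v : Fin (n + 1) → F | v ≠ 0 ∧ ∃ l : F, v ᵥ* M = l • (fun i => σ (v i))} :
      Finset _) ⊆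
      ({v : Fin (n + 1) → F | v ∈ LinearMap.ker L} : Finset _).erase 0 ∪
      ({x : Fin r → F | x ≠ 0 ∧ ∃ l : F, ∀ i, x i * m i = l * σ (x i)} : Finset _).image
        (fun x => ∑ i, x i • e i) := by
    intro v hv
    simp only [Finset.mem_filter, Finset.mem_univ, true_and] at hv
    obtain ⟨hv0, l, hl⟩ := hv
    rw [Finset.mem_union]
    by_cases hl0 : l = 0
    · left
      simp only [Finset.mem_erase, Finset.mem_filter, Finset.mem_univ, true_and]
      refine ⟨hv0, ?_⟩
      rw [LinearMap.mem_ker]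
      exact hl.trans (by rw [hl0, zero_smul])
    · right
      have hvs : v ∈ Submodule.span F (Set.range e) := by
        rw [herange, hspan]
        exact Submodule.subset_span ⟨l, hl0, hl⟩
      obtain ⟨x, rfl⟩ := (Submodule.mem_span_range_iff_exists_fun F).1 hvs
      refine Finset.mem_image.2 ⟨x, ?_, rfl⟩
      simp only [Finset.mem_filter, Finset.mem_univ, true_and]
      refine ⟨?_, l, fun i => ?_⟩
      · rintro rfl
        simp at hv0
      · have h1 : L (∑ i, x i • e i) = l • c (∑ i, x i • e i) := hl
        rw [hLsum, hcsum, Finset.smul_sum] at h1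
        simp only [smul_smul] at h1
        rw [Fintype.linearIndependent_iff] at hce
        have h2 := hce (fun i => x i * m i - l * σ (x i))
          (by simp only [sub_smul, Finset.sum_sub_distrib, h1, sub_self]) i
        exact sub_eq_zero.1 h2
  have hker : (({v : Fin (n + 1) → F | v ∈ LinearMap.ker L} : Finset _).erase 0).card
      = (∑ i ∈ Finset.range k, q ^ i) * (q - 1) := by
    rw [Finset.card_erase_of_mem (by simp), ← Fintype.card_subtype]
    have : Fintype.card {x // x ∈ LinearMap.ker L} = q ^ k := Module.card_eq_pow_finrank
    rw [this, geom_sum_mul_of_one_le hq1.le]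
  calc _ ≤ _ := Finset.card_le_card hsub
    _ ≤ _ := Finset.card_union_le _ _
    _ ≤ _ := Nat.add_le_add hker.le
      (Finset.card_image_le.trans (card_diagonal_eigenvectors_le σ r m hm))
    _ = _ := by rw [add_mul, mul_comm (Fintype.card F - 1)]

/-- The cardinality of a finite field in terms of the fixed points of an automorphism. -/
lemma card_eq_card_fixed_pow_orderOf {F : Type} [Field F] [Fintype F] (σ : RingAut F) :
    Fintype.card F = Nat.card {a : F // σ a = a} ^ orderOf σ := by
  classical
  let G := Subgroup.zpowers σ
  have : Finite (RingAut F) := DFunLike.finite _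
  have : Fintype G := Fintype.ofFinite G
  have h1 : Module.finrank (FixedPoints.subfield G F) F = orderOf σ := by
    rw [FixedPoints.finrank_eq_card, ← Nat.card_eq_fintype_card, Nat.card_zpowers]
  have h2 := Module.natCard_eq_pow_finrank (K := FixedPoints.subfield G F) (V := F)
  rw [h1, Nat.card_eq_fintype_card] at h2
  rw [h2]
  congr 1
  refine Nat.card_congr (Equiv.subtypeEquivRight fun a => ⟨fun h => ?_, fun h => ?_⟩)
  · exact h ⟨σ, Subgroup.mem_zpowers σ⟩
  · rintro ⟨g, hg⟩
    have : Subgroup.zpowers σ ≤ MulAction.stabilizer (RingAut F) a := by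
      rw [Subgroup.zpowers_le]
      exact h
    exact this hg

/-- A rank one idempotent attains the hyperplane count plus one. -/
lemma le_theta_single {F : Type} [Field F] [Fintype F] (n : ℕ) (σ : F ≃+* F) :
    ∑ i ∈ Finset.range n, Fintype.card F ^ i + 1 ≤
      theta σ (Matrix.single (0 : Fin (n + 1)) (0 : Fin (n + 1)) (1 : F)) := by
  classical
  set q := Fintype.card F with hq
  have hq1 : 1 < q := Fintype.one_lt_card
  refine Nat.le_of_mul_le_mul_right ?_ (show 0 < q - 1 by omega)
  have hmul : ∀ v : Fin (n + 1) → F,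
      v ᵥ* Matrix.single (0 : Fin (n + 1)) (0 : Fin (n + 1)) (1 : F) = Pi.single 0 (v 0) := by
    intro v
    ext j
    refine Fin.cases ?_ (fun j => ?_) j <;>
      simp [Matrix.vecMul, dotProduct, Matrix.single_apply, (Fin.succ_ne_zero _).symm]
  rw [theta_mul_card_sub_one, add_mul, geom_sum_mul_of_one_le hq1.le, one_mul]
  have hcard : Nat.card ({w : Fin n → F // w ≠ 0} ⊕ Fˣ) = q ^ n - 1 + (q - 1) := by
    rw [Nat.card_sum, Nat.card_eq_fintype_card, Nat.card_eq_fintype_card, Fintype.card_units,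
      Fintype.card_subtype_compl, Fintype.card_subtype_eq, Fintype.card_fun, Fintype.card_fin]
  rw [← hcard]
  refine Nat.card_le_card_of_injective (Sum.elim
    (fun w => ⟨Fin.cons 0 w.1, fun h => w.2 ?_, 0, ?_⟩)
    (fun u => ⟨Pi.single 0 (u : F), ?_, u / σ u, ?_⟩)) ?_
  · ext i
    simpa using congrFun h i.succ
  · rw [hmul]
    simp
  · simp
  · rw [hmul]
    have hu : σ (u : F) ≠ 0 := by simp
    ext j
    refine Fin.cases ?_ (fun j => ?_) j <;> simp
  · refine Function.Injective.sumElim ?_ ?_ ?_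
    · intro w w' h
      simpa [Subtype.ext_iff] using h
    · intro u u' h
      simpa [Units.ext_iff] using h
    · intro w u h
      have := congrFun (congrArg Subtype.val h) 0
      simp at this
      exact u.ne_zero this.symm

/-- The identity matrix fixes the subplane over the fixed field of `σ`. -/
lemma le_theta_one {F : Type} [Field F] [Fintype F] (σ : F ≃+* F) :
    Nat.card {a : F // σ a = a} ^ 2 + Nat.card {a : F // σ a = a} + 1 ≤
      theta σ (1 : Matrix (Fin (2 + 1)) (Fin (2 + 1)) F) := by
  classical
  set q := Fintype.card F with hq
  have hq1 : 1 < q := Fintype.one_lt_card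
  refine Nat.le_of_mul_le_mul_right ?_ (show 0 < q - 1 by omega)
  rw [theta_mul_card_sub_one]
  let S := {a : F // σ a = a}
  have hcard : Nat.card (((S × S) ⊕ S ⊕ Unit) × Fˣ) =
      (Nat.card S ^ 2 + Nat.card S + 1) * (q - 1) := by
    rw [Nat.card_prod, Nat.card_sum, Nat.card_sum, Nat.card_prod, Nat.card_unique (α := Unit),
      Nat.card_eq_fintype_card (α := Fˣ), Fintype.card_units]
    ring
  rw [← hcard]
  let g : (S × S) ⊕ S ⊕ Unit → Fin (2 + 1) → F :=
    Sum.elim (fun p => ![1, p.1, p.2]) (Sum.elim (fun a => ![0, 1, a]) (fun _ => ![0, 0, 1]))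
  have hg0 : ∀ x, g x ≠ 0 := by
    rintro (x | x | x) h
    · simpa [g] using congrFun h 0
    · simpa [g] using congrFun h 1
    · simpa [g] using congrFun h 2
  have hgσ : ∀ x i, σ (g x i) = g x i := by
    rintro (⟨⟨x, hx⟩, ⟨y, hy⟩⟩ | ⟨x, hx⟩ | x) i <;> fin_cases i <;> simp [g, *]
  refine Nat.card_le_card_of_injective (fun p => ⟨(p.2 : F) • g p.1,
    smul_ne_zero p.2.ne_zero (hg0 _), p.2 / σ p.2, ?_⟩) ?_
  · have hu : σ (p.2 : F) ≠ 0 := by simp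
    ext i
    simp only [Matrix.vecMul_one, Pi.smul_apply, smul_eq_mul, map_mul, hgσ]
    field_simp
  · rintro ⟨x, u⟩ ⟨y, v⟩ h
    have h := congrArg Subtype.val h
    have h0 := congrFun h 0
    have h1 := congrFun h 1
    have h2 := congrFun h 2
    clear h
    rcases x with ⟨x1, x2⟩ | x | x <;> rcases y with ⟨y1, y2⟩ | y | y <;>
      simp only [g, Sum.elim_inl, Sum.elim_inr, Pi.smul_apply, smul_eq_mul, Matrix.cons_val,
        mul_one, mul_zero, Units.ne_zero, (Units.ne_zero _).symm, Units.val_inj] at h0 h1 h2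
    · subst h0
      rw [Subtype.ext (mul_left_cancel₀ u.ne_zero h1), Subtype.ext (mul_left_cancel₀ u.ne_zero h2)]
    · subst h1
      rw [Subtype.ext (mul_left_cancel₀ u.ne_zero h2)]
    · rw [h2]

lemma geom_sum_add_geom_sum_le {q s n k r : ℕ} (hs : 1 ≤ s) (hsq : s ≤ q) (hk1 : 1 ≤ k)
    (hkn : k ≤ n) (hr : r + k ≤ n + 1) :
    ∑ i ∈ Finset.range k, q ^ i + ∑ j ∈ Finset.range r, s ^ j ≤
      ∑ i ∈ Finset.range n, q ^ i + 1 := by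
  obtain ⟨d, rfl⟩ := Nat.exists_eq_add_of_le hkn
  have h1 : ∑ j ∈ Finset.range r, s ^ j ≤ ∑ j ∈ Finset.range (d + 1), s ^ j :=
    Finset.sum_le_sum_of_subset (Finset.range_mono (by omega))
  rw [Finset.sum_range_succ', pow_zero] at h1
  rw [Finset.sum_range_add]
  have h2 : ∑ j ∈ Finset.range d, s ^ (j + 1) ≤ ∑ j ∈ Finset.range d, q ^ (k + j) :=
    Finset.sum_le_sum fun j _ => (Nat.pow_le_pow_right hs (by omega)).trans
      (Nat.pow_le_pow_left hsq _)
  omega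

lemma geom_sum_le_geom_sum_add_one {q s n : ℕ} (hs : 2 ≤ s) (hsq : s ^ 2 ≤ q) (hn : 2 ≤ n)
    (h : s ^ 3 ≤ q ∨ 2 < n) :
    ∑ j ∈ Finset.range (n + 1), s ^ j ≤ ∑ i ∈ Finset.range n, q ^ i + 1 := by
  have hsq' : s ≤ q := by nlinarith
  have hstep : ∀ d a : ℕ, ∑ j ∈ Finset.range (a + 1), s ^ j ≤ ∑ i ∈ Finset.range a, q ^ i + 1 →
      1 ≤ a → ∑ j ∈ Finset.range (a + d + 1), s ^ j ≤ ∑ i ∈ Finset.range (a + d), q ^ i + 1 := by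
    intro d a ha ha1
    induction d with
    | zero => exact ha
    | succ d ih =>
      rw [← add_assoc, Finset.sum_range_succ, Finset.sum_range_succ (fun i => q ^ i)]
      have : s ^ (a + d + 1) ≤ q ^ (a + d) :=
        calc s ^ (a + d + 1) ≤ s ^ (2 * (a + d)) := Nat.pow_le_pow_right (by omega) (by omega)
          _ = (s ^ 2) ^ (a + d) := pow_mul _ _ _
          _ ≤ q ^ (a + d) := Nat.pow_le_pow_left hsq _
      omega
  rcases h with h | h
  · obtain ⟨d, rfl⟩ := Nat.exists_eq_add_of_le hn
    refine hstep d 2 ?_ (by omega)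
    simp only [Finset.sum_range_succ, Finset.sum_range_zero]
    nlinarith [Nat.mul_le_mul hs (le_refl (s ^ 2))]
  · obtain ⟨d, rfl⟩ := Nat.exists_eq_add_of_le (show 3 ≤ n from h)
    refine hstep d 3 ?_ (by omega)
    simp only [Finset.sum_range_succ, Finset.sum_range_zero]
    have h4 : s ^ 4 ≤ q ^ 2 := by nlinarith
    have h5 : 2 * s ^ 3 ≤ s ^ 4 := by
      rw [pow_succ s 3]
      nlinarith [Nat.zero_le (s ^ 3)]
    have h6 : s ≤ s ^ 3 := by nlinarith [Nat.one_le_pow 2 s (by omega)]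
    nlinarith

theorem stmt_9 (F : Type) [Field F] [Fintype F] (n : ℕ) (hn : 2 ≤ n)
    (σ : F ≃+* F) (hσ : σ ≠ RingEquiv.refl F)
    (s : ℕ) (hs : s = Nat.card {a : F // σ a = a}) :
    ((σ.trans σ = RingEquiv.refl F ∧ n = 2) →
      IsGreatest {t : ℕ | ∃ M : Matrix (Fin (n + 1)) (Fin (n + 1)) F, M ≠ 0 ∧ theta σ M = t}
        (s ^ 2 + s + 1)) ∧
    ((σ.trans σ ≠ RingEquiv.refl F ∨ 2 < n) →
      IsGreatest {t : ℕ | ∃ M : Matrix (Fin (n + 1)) (Fin (n + 1)) F, M ≠ 0 ∧ theta σ M = t}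
        (((Fintype.card F) ^ n - 1) / ((Fintype.card F) - 1) + 1)) := by
  classical
  set q := Fintype.card F with hq
  have hq1 : 1 < q := Fintype.one_lt_card
  let τ : RingAut F := σ
  have hcard : q = s ^ orderOf τ := by
    rw [hs]
    exact card_eq_card_fixed_pow_orderOf τ
  have hs2 : 2 ≤ s := by
    rw [hs]
    have : Nontrivial {a : F // σ a = a} :=
      ⟨⟨0, map_zero σ⟩, ⟨1, map_one σ⟩, by simp [Subtype.ext_iff]⟩
    exact Finite.one_lt_card
  have : Finite (RingAut F) := DFunLike.finite _
  have hpos : 0 < orderOf τ := orderOf_pos τ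
  have hne1 : orderOf τ ≠ 1 := fun h => hσ (orderOf_eq_one_iff.1 h)
  have htwo : τ ^ 2 = 1 ↔ σ.trans σ = RingEquiv.refl F := by
    rw [pow_two]
    exact Iff.rfl
  have hsq : s ^ 2 ≤ q := hcard ▸ Nat.pow_le_pow_right (by omega) (by omega)
  have hsq' : s ≤ q := by nlinarith
  have hgeom : (q ^ n - 1) / (q - 1) = ∑ i ∈ Finset.range n, q ^ i :=
    (Nat.geomSum_eq hq1 n).symm
  have hmono : ∀ r, r ≤ n + 1 →
      ∑ j ∈ Finset.range r, s ^ j ≤ ∑ j ∈ Finset.range (n + 1), s ^ j := fun r hr =>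
    Finset.sum_le_sum_of_subset (Finset.range_mono hr)
  constructor
  · rintro ⟨h2, rfl⟩
    have hqs : q = s ^ 2 := by
      have h3 : orderOf τ ≤ 2 := orderOf_le_of_pow_eq_one (by norm_num) (htwo.2 h2)
      rw [hcard, show orderOf τ = 2 by omega]
    have hub : ∀ M : Matrix (Fin (2 + 1)) (Fin (2 + 1)) F, M ≠ 0 →
        theta σ M ≤ s ^ 2 + s + 1 := by
      intro M hM
      obtain ⟨k, r, hk, hrk, hle⟩ := exists_theta_le σ M hM
      rw [← hs, ← hq] at hle
      refine hle.trans ?_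
      rcases Nat.eq_zero_or_pos k with rfl | hk1
      · have := hmono r (by omega)
        simp only [Finset.sum_range_succ, Finset.sum_range_zero, pow_zero, pow_one] at this ⊢
        omega
      · have := geom_sum_add_geom_sum_le (by omega) hsq' hk1 hk hrk
        rw [Finset.sum_range_succ, Finset.sum_range_one, pow_zero, pow_one] at this
        omega
    refine ⟨⟨1, one_ne_zero, (hub 1 one_ne_zero).antisymm ?_⟩, ?_⟩
    · rw [hs]
      exact le_theta_one σ
    · rintro _ ⟨M, hM, rfl⟩
      exact hub M hM
  · intro h
    rw [hgeom]
    have h' : s ^ 3 ≤ q ∨ 2 < n := by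
      refine h.imp_left fun h2 => ?_
      have h3 : orderOf τ ≠ 2 := fun h3 => h2 (htwo.1 (h3 ▸ pow_orderOf_eq_one τ))
      rw [hcard]
      exact Nat.pow_le_pow_right (by omega) (by omega)
    have hub : ∀ M : Matrix (Fin (n + 1)) (Fin (n + 1)) F, M ≠ 0 →
        theta σ M ≤ ∑ i ∈ Finset.range n, q ^ i + 1 := by
      intro M hM
      obtain ⟨k, r, hk, hrk, hle⟩ := exists_theta_le σ M hM
      rw [← hs, ← hq] at hle
      refine hle.trans ?_
      rcases Nat.eq_zero_or_pos k with rfl | hk1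
      · have h1 := hmono r (by omega)
        have h2 := geom_sum_le_geom_sum_add_one hs2 hsq hn h'
        rw [Finset.sum_range_zero]
        omega
      · exact geom_sum_add_geom_sum_le (by omega) hsq' hk1 hk hrk
    have hne : Matrix.single (0 : Fin (n + 1)) (0 : Fin (n + 1)) (1 : F) ≠ 0 := fun h0 => by
      simpa using congrFun (congrFun h0 0) 0
    refine ⟨⟨_, hne, (hub _ hne).antisymm (le_theta_single n σ)⟩, ?_⟩
    rintro _ ⟨M, hM, rfl⟩
    exact hub M hM
end

section
/- Suppose n = 2, q = s² and σ is the automorphism σ(a) = a^s of F_q (so σ ≠ id and σ² = id). A nonzero 3×3 matrix M over F_q satisfies wt(c_M) = q³ − s³ (i.e. c_M is a minimum weight codeword of C(Λ_σ)) if and only if there exist three linearly independent row vectors ξ₁, ξ₂, ξ₃ ∈ F_q³ and nonzero scalars α, β, γ ∈ F_q with ξ₁·M = α·ξ₁^σ, ξ₂·M = β·ξ₂^σ, ξ₃·M = γ·ξ₃^σ and α^{s+1} = β^{s+1} = γ^{s+1}. -/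
open Matrix

/-- `wt σ M` : the Hamming weight of the codeword `c_M` of `C(Λ_σ)`, i.e. the number of
pairs of projective points `([x],[ξ])` with `ξ·x = 0` and `ξ·M·x^σ ≠ 0`. -/
noncomputable def wt {F : Type} [Field F] [Fintype F] {n : ℕ}
    (σ : F ≃+* F) (M : Matrix (Fin (n + 1)) (Fin (n + 1)) F) : ℕ :=
  Nat.card {pq : Projectivization F (Fin (n + 1) → F) × Projectivization F (Fin (n + 1) → F) //
    pq.2.rep ⬝ᵥ pq.1.rep = 0 ∧ (pq.2.rep ᵥ* M) ⬝ᵥ (fun i => σ (pq.1.rep i)) ≠ 0}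

theorem Projectivization.card_subtype_rep_mul {K V : Type*} [Field K] [AddCommGroup V] [Module K V]
    (P : V → Prop) (hP : ∀ (c : K) (v : V), c ≠ 0 → (P (c • v) ↔ P v)) :
    Nat.card {p : Projectivization K V // P p.rep} * Nat.card Kˣ =
      Nat.card {v : V // v ≠ 0 ∧ P v} := by
  rw [← Nat.card_prod]
  refine Nat.card_congr (Equiv.ofBijective (fun x => ⟨x.2 • x.1.1.rep,
    (smul_ne_zero_iff_ne x.2).2 x.1.1.rep_nonzero,
    (hP _ _ x.2.ne_zero).2 x.1.2⟩) ⟨?_, ?_⟩)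
  · rintro ⟨⟨p, hp⟩, u⟩ ⟨⟨r, hr⟩, w⟩ h
    simp only [Subtype.mk.injEq] at h
    have hpr : p = r := by
      rw [← p.mk_rep, ← r.mk_rep, Projectivization.mk_eq_mk_iff]
      exact ⟨u⁻¹ * w, by rw [mul_smul, ← h, inv_smul_smul]⟩
    subst hpr
    have huw : (u : K) = w := smul_left_injective K p.rep_nonzero h
    simp [Units.ext huw]
  · rintro ⟨v, hv, hPv⟩
    obtain ⟨a, ha⟩ := Projectivization.exists_smul_eq_mk_rep K v hv
    refine ⟨⟨⟨Projectivization.mk K v hv, ?_⟩, a⁻¹⟩, ?_⟩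
    · rw [← ha]
      exact (hP _ _ a.ne_zero).2 hPv
    · simp [← ha]

theorem card_dotProduct_eq_zero {F : Type*} [Field F] [Fintype F] {ξ : Fin 3 → F} (hξ : ξ ≠ 0) :
    Nat.card {x : Fin 3 → F // ξ ⬝ᵥ x = 0} = Fintype.card F ^ 2 := by
  have h := LinearMap.finrank_range_add_finrank_ker (dotProductBilin F F ξ)
  have hs : Function.Surjective (dotProductBilin F F ξ) := by
    apply LinearMap.surjective
    intro h0
    apply hξ
    ext i
    simpa using LinearMap.congr_fun h0 (Pi.single i 1)
  rw [LinearMap.range_eq_top.2 hs] at h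
  simp only [finrank_top, Module.finrank_self, Module.finrank_fin_fun] at h
  have := Module.natCard_eq_pow_finrank (K := F) (V := LinearMap.ker (dotProductBilin F F ξ))
  rw [show Module.finrank F (LinearMap.ker (dotProductBilin F F ξ)) = 2 by omega,
    Nat.card_eq_fintype_card (α := F)] at this
  rw [← this]
  exact Nat.card_congr (Equiv.refl _)

theorem card_dotProduct_eq_zero_pair {F : Type*} [Field F] [Fintype F] {ξ w : Fin 3 → F}
    (hξ : ξ ≠ 0) (hw : ∀ c : F, w ≠ c • ξ) :
    Nat.card {x : Fin 3 → F // ξ ⬝ᵥ x = 0 ∧ w ⬝ᵥ x = 0} = Fintype.card F := by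
  have hli : LinearIndependent F ![ξ, w] := by
    rw [LinearIndependent.pair_iff' hξ]
    exact fun a h => hw a h.symm
  let A : Matrix (Fin 2) (Fin 3) F := Matrix.of ![ξ, w]
  have hr : A.rank = 2 := by simpa using LinearIndependent.rank_matrix (M := A) hli
  have h := LinearMap.finrank_range_add_finrank_ker A.mulVecLin
  rw [← Matrix.rank, hr, Module.finrank_fin_fun] at h
  have := Module.natCard_eq_pow_finrank (K := F) (V := LinearMap.ker A.mulVecLin)
  rw [show Module.finrank F (LinearMap.ker A.mulVecLin) = 1 by omega,
    Nat.card_eq_fintype_card (α := F), pow_one] at this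
  rw [← this]
  refine Nat.card_congr (Equiv.subtypeEquivRight fun x => ?_)
  simp [A, funext_iff, Fin.forall_fin_two]

theorem Nat.card_subtype_and_not_add {α : Type*} [Finite α] (P Q : α → Prop) :
    Nat.card {x // P x ∧ ¬ Q x} + Nat.card {x // P x ∧ Q x} = Nat.card {x // P x} := by
  classical
  have := Fintype.ofFinite α
  simp only [Nat.card_eq_fintype_card, Fintype.card_subtype, ← Finset.filter_filter]
  rw [add_comm, Finset.card_filter_add_card_filter_not]

/-- `ξ` spans a line fixed or annihilated by the semilinear map induced by `M` and `σ`. -/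
def IsSemiEigen {F : Type*} [Field F] {n : ℕ} (σ : F ≃+* F) (M : Matrix (Fin n) (Fin n) F)
    (ξ : Fin n → F) : Prop :=
  ∃ μ : F, ξ ᵥ* M = μ • (fun i => σ (ξ i))

theorem card_points_dotProduct {F : Type} [Field F] [Fintype F] (σ : F ≃+* F)
    (M : Matrix (Fin 3) (Fin 3) F) {ξ : Fin 3 → F} (hξ : ξ ≠ 0) (h : ¬ IsSemiEigen σ M ξ) :
    Nat.card {p : Projectivization F (Fin 3 → F) //
      ξ ⬝ᵥ p.rep = 0 ∧ (ξ ᵥ* M) ⬝ᵥ (fun i => σ (p.rep i)) ≠ 0} = Fintype.card F := by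
  classical
  let w : Fin 3 → F := fun i => σ.symm ((ξ ᵥ* M) i)
  have hw (x : Fin 3 → F) : (ξ ᵥ* M) ⬝ᵥ (fun i => σ (x i)) = σ (w ⬝ᵥ x) := by
    simp [dotProduct, w]
  have hwc : ∀ c : F, w ≠ c • ξ := by
    intro c hc
    refine h ⟨σ c, funext fun i => ?_⟩
    have := congrArg σ (congrFun hc i)
    simpa [w] using this
  have key := Projectivization.card_subtype_rep_mul (K := F) (V := Fin 3 → F)
    (fun x => ξ ⬝ᵥ x = 0 ∧ (ξ ᵥ* M) ⬝ᵥ (fun i => σ (x i)) ≠ 0)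
    (by intro c v hc; rw [hw, hw]; simp [dotProduct_smul, hc])
  simp only [hw] at key ⊢
  have e : Nat.card {x : Fin 3 → F // x ≠ 0 ∧ ξ ⬝ᵥ x = 0 ∧ σ (w ⬝ᵥ x) ≠ 0} =
      Nat.card {x : Fin 3 → F // ξ ⬝ᵥ x = 0 ∧ ¬ w ⬝ᵥ x = 0} := by
    refine Nat.card_congr (Equiv.subtypeEquivRight fun x => ?_)
    simp only [ne_eq, map_eq_zero, and_iff_right_iff_imp, and_imp]
    rintro _ h2 rfl
    simp at h2
  have s := Nat.card_subtype_and_not_add (fun x : Fin 3 → F => ξ ⬝ᵥ x = 0) (fun x => w ⬝ᵥ x = 0)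
  rw [card_dotProduct_eq_zero hξ, card_dotProduct_eq_zero_pair hξ hwc, ← e, ← key,
    Nat.card_units, Nat.card_eq_fintype_card (α := F)] at s
  have hq : 1 < Fintype.card F := Fintype.one_lt_card
  obtain ⟨m, hm⟩ : ∃ m, Fintype.card F = m + 2 := ⟨_, (Nat.sub_add_cancel hq).symm⟩
  rw [hm] at s ⊢
  simp only [Nat.add_one_sub_one] at s
  exact Nat.eq_of_mul_eq_mul_right (Nat.succ_pos m) (by linarith)

theorem wt_add_card_isSemiEigen {F : Type} [Field F] [Fintype F] (σ : F ≃+* F)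
    (M : Matrix (Fin 3) (Fin 3) F) :
    wt σ M + Fintype.card F *
      Nat.card {p : Projectivization F (Fin 3 → F) // IsSemiEigen σ M p.rep} =
      Fintype.card F * (Fintype.card F ^ 2 + Fintype.card F + 1) := by
  classical
  have : Fintype (Projectivization F (Fin 3 → F)) := Fintype.ofFinite _
  have hbad {ξ : Fin 3 → F} (h : IsSemiEigen σ M ξ) :
      Nat.card {p : Projectivization F (Fin 3 → F) //
        ξ ⬝ᵥ p.rep = 0 ∧ (ξ ᵥ* M) ⬝ᵥ (fun i => σ (p.rep i)) ≠ 0} = 0 := by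
    obtain ⟨μ, hμ⟩ := h
    rw [Nat.card_eq_zero]
    left
    refine ⟨fun ⟨p, h1, h2⟩ => h2 ?_⟩
    have h3 : (fun i => σ (ξ i)) ⬝ᵥ (fun i => σ (p.rep i)) = σ (ξ ⬝ᵥ p.rep) := by
      simp [dotProduct]
    rw [hμ, smul_dotProduct, h3, h1]
    simp
  have hwt : wt σ M = Nat.card (Σ r : Projectivization F (Fin 3 → F),
      {p : Projectivization F (Fin 3 → F) //
        r.rep ⬝ᵥ p.rep = 0 ∧ (r.rep ᵥ* M) ⬝ᵥ (fun i => σ (p.rep i)) ≠ 0}) := by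
    refine Nat.card_congr ⟨fun x => ⟨x.1.2, x.1.1, x.2⟩, fun x => ⟨(x.2.1, x.1), x.2.2⟩,
      fun _ => rfl, fun _ => rfl⟩
  have hc : Nat.card (Projectivization F (Fin 3 → F)) =
      Fintype.card F ^ 2 + Fintype.card F + 1 := by
    rw [Projectivization.card_of_finrank F _ (Module.finrank_fin_fun F)]
    simp [Finset.sum_range_succ]
    ring
  rw [hwt, Nat.card_sigma]
  have hsum (r : Projectivization F (Fin 3 → F)) :
      Nat.card {p : Projectivization F (Fin 3 → F) //
        r.rep ⬝ᵥ p.rep = 0 ∧ (r.rep ᵥ* M) ⬝ᵥ (fun i => σ (p.rep i)) ≠ 0} =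
      if IsSemiEigen σ M r.rep then 0 else Fintype.card F := by
    split_ifs with h
    · exact hbad h
    · exact card_points_dotProduct σ M r.rep_nonzero h
  rw [Finset.sum_congr rfl fun r _ => hsum r, Finset.sum_ite]
  simp only [Finset.sum_const, smul_eq_mul, mul_zero, zero_add]
  rw [mul_comm, ← mul_add, ← hc, Nat.card_eq_fintype_card, Nat.card_eq_fintype_card,
    Fintype.card_subtype, add_comm, Finset.card_filter_add_card_filter_not, Finset.card_univ]

theorem wt_eq_iff_card_isSemiEigen {F : Type} [Field F] [Fintype F] {s : ℕ}
    (hq : Fintype.card F = s ^ 2) (σ : F ≃+* F) (M : Matrix (Fin 3) (Fin 3) F) :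
    wt σ M = Fintype.card F ^ 3 - s ^ 3 ↔
      Nat.card {ξ : Fin 3 → F // ξ ≠ 0 ∧ IsSemiEigen σ M ξ} = (s + 1) * (s ^ 3 - 1) := by
  have h1 : 1 < Fintype.card F := Fintype.one_lt_card
  have hs : 2 ≤ s := by
    by_contra! h
    interval_cases s <;> omega
  have key := Projectivization.card_subtype_rep_mul (K := F) (V := Fin 3 → F)
    (IsSemiEigen σ M) (by
      intro c v hc
      have hσc : σ c ≠ 0 := by simpa using hc
      constructor
      · rintro ⟨μ, hμ⟩
        refine ⟨c⁻¹ * μ * σ c, ?_⟩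
        rw [smul_vecMul] at hμ
        calc v ᵥ* M = c⁻¹ • (c • v ᵥ* M) := by rw [inv_smul_smul₀ hc]
          _ = _ := by
            rw [hμ]
            ext i
            simp
            ring
      · rintro ⟨μ, hμ⟩
        refine ⟨c * μ * (σ c)⁻¹, ?_⟩
        rw [smul_vecMul, hμ]
        ext i
        simp
        field_simp)
  have hw := wt_add_card_isSemiEigen σ M
  rw [← key, Nat.card_units, Nat.card_eq_fintype_card (α := F)]
  generalize Nat.card {p : Projectivization F (Fin 3 → F) // IsSemiEigen σ M p.rep} = N at *
  rw [hq] at *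
  have e : (s + 1) * (s ^ 3 - 1) = (s ^ 2 + s + 1) * (s ^ 2 - 1) := by
    have : 1 ≤ s ^ 3 := Nat.one_le_pow _ _ (by omega)
    zify [this, h1.le]
    ring
  rw [e, Nat.mul_left_inj (by omega)]
  have h3 : s ^ 3 ≤ (s ^ 2) ^ 3 := by
    rw [← pow_mul]
    exact Nat.pow_le_pow_right (by omega) (by norm_num)
  rw [← Nat.mul_right_inj (a := s ^ 2) (b := N) (by positivity)]
  have e2 : s ^ 2 * ((s ^ 2) ^ 2 + s ^ 2 + 1) = (s ^ 2) ^ 3 + s ^ 4 + s ^ 2 := by ring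
  have e3 : s ^ 2 * (s ^ 2 + s + 1) = s ^ 4 + s ^ 3 + s ^ 2 := by ring
  omega

theorem iSupIndep.sum_finrank_le {K V ι : Type*} [Field K] [AddCommGroup V] [Module K V]
    [FiniteDimensional K V] {E : ι → Submodule K V} (hE : iSupIndep E) (t : Finset ι) :
    ∑ i ∈ t, Module.finrank K (E i) ≤ Module.finrank K V := by
  classical
  suffices h : ∑ i ∈ t, Module.finrank K (E i) = Module.finrank K (t.sup E : Submodule K V) from
    h ▸ Submodule.finrank_le _
  induction t using Finset.induction_on with
  | empty => rw [Finset.sum_empty, Finset.sup_empty, finrank_bot]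
  | insert i t hi ih =>
    have hd : Disjoint (E i) (t.sup E) :=
      (iSupIndep_iff_supIndep.1 hE (insert i t)) (Finset.subset_insert i t)
        (Finset.mem_insert_self i t) hi
    have := Submodule.finrank_sup_add_finrank_inf_eq (E i) (t.sup E)
    rw [hd.eq_bot, finrank_bot, add_zero] at this
    rw [Finset.sum_insert hi, Finset.sup_insert, ih, this]

/-- The nonzero vectors `ξ` with `ξ M = μ ξ^σ` for some `μ` satisfying `μ ^ (s + 1) = ν`. -/
def semiEigenSet {F : Type*} [Field F] {n : ℕ} (s : ℕ) (σ : F ≃+* F) (M : Matrix (Fin n) (Fin n) F)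
    (ν : F) : Set (Fin n → F) :=
  {ξ | ξ ≠ 0 ∧ ∃ μ : F, ξ ᵥ* M = μ • (fun i => σ (ξ i)) ∧ μ ^ (s + 1) = ν}

section UpperBound

variable {F : Type*} [Field F] [Fintype F] {s : ℕ} {σ : F ≃+* F}

theorem semiEigenSet_subset_eigenspace {n : ℕ} (hq : Fintype.card F = s ^ 2)
    (hσ : ∀ a : F, σ a = a ^ s) (M : Matrix (Fin n) (Fin n) F) (ν : F) :
    semiEigenSet s σ M ν ⊆ Module.End.eigenspace (M * M.map σ).vecMulLinear ν := by
  rintro ξ ⟨-, μ, hμ, hν⟩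
  have hσσ (a : F) : σ (σ a) = a := by
    rw [hσ, hσ, ← pow_mul, ← sq, ← hq, FiniteField.pow_card]
  have h2 : (fun i => σ (ξ i)) ᵥ* M.map σ = fun i => σ ((ξ ᵥ* M) i) := by
    ext i
    simp [vecMul, dotProduct]
  rw [SetLike.mem_coe, Module.End.mem_eigenspace_iff, Matrix.vecMulLinear_apply, ← vecMul_vecMul,
    hμ, smul_vecMul, h2, hμ]
  ext i
  simp [hσσ, ← hν, pow_succ', hσ μ, mul_assoc]

theorem ncard_smul_le {V : Type*} [AddCommGroup V] [Module F V] {X : Set V} {u : V}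
    (hX : ∀ v ∈ X, v ≠ 0 ∧ ∃ a : F, v = a • u) : X.ncard ≤ Fintype.card F - 1 := by
  classical
  rw [← Fintype.card_units, ← Finset.card_univ]
  refine (Set.ncard_le_ncard (t := ((Finset.univ.image fun c : Fˣ => c • u : Finset V) : Set V))
    ?_).trans ?_
  · intro v hv
    obtain ⟨h0, a, rfl⟩ := hX v hv
    have ha : a ≠ 0 := fun h => h0 (by simp [h])
    exact Finset.mem_coe.2 (Finset.mem_image.2 ⟨Units.mk0 a ha, Finset.mem_univ _, rfl⟩)
  · rw [Set.ncard_coe_finset]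
    exact Finset.card_image_le

theorem ncard_semiEigenSet_le_of_span_pair {n : ℕ} (hs : 2 ≤ s) (hσ : ∀ a : F, σ a = a ^ s)
    {M : Matrix (Fin n) (Fin n) F} {ν : F} (hν : ν ≠ 0) {u w : Fin n → F}
    (hu : u ∈ semiEigenSet s σ M ν) (hw : w ∈ semiEigenSet s σ M ν)
    (huw : LinearIndependent F ![u, w])
    (h : ∀ v ∈ semiEigenSet s σ M ν, ∃ a b : F, a • u + b • w = v) :
    (semiEigenSet s σ M ν).ncard ≤ (Fintype.card F - 1) * (s + 1) := by
  classical
  obtain ⟨-, α, hα, hαν⟩ := hu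
  obtain ⟨-, β, hβ, hβν⟩ := hw
  have hβ0 : β ≠ 0 := by
    rintro rfl
    exact hν (by simp [← hβν])
  let P : Polynomial F := Polynomial.C β * Polynomial.X ^ s - Polynomial.C α * Polynomial.X
  have hP : P ≠ 0 := by
    intro h0
    have := congrArg (fun p => Polynomial.coeff p s) h0
    simp [P, Polynomial.coeff_X, show (1 : ℕ) ≠ s by omega, hβ0] at this
  have hPdeg : P.natDegree ≤ s := by
    refine (Polynomial.natDegree_sub_le _ _).trans (max_le ?_ ?_)
    · exact Polynomial.natDegree_C_mul_X_pow_le β s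
    · exact (Polynomial.natDegree_C_mul_le α _).trans (Polynomial.natDegree_X_le.trans (by omega))
  let T : Finset F := P.roots.toFinset
  have hT : T.card ≤ s :=
    (Multiset.toFinset_card_le _).trans ((Polynomial.card_roots' P).trans hPdeg)
  let g : Fˣ × Option F → (Fin n → F) := fun x => x.1 • x.2.elim u (fun t => t • u + w)
  let B : Finset (Fˣ × Option F) := Finset.univ ×ˢ Finset.insertNone T
  have hB : (B.image g).card ≤ (Fintype.card F - 1) * (s + 1) := by
    refine Finset.card_image_le.trans ?_
    rw [Finset.card_product, Finset.card_univ, Fintype.card_units, Finset.card_insertNone]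
    exact Nat.mul_le_mul_left _ (by omega)
  refine le_trans ?_ hB
  rw [← Set.ncard_coe_finset]
  refine Set.ncard_le_ncard fun v hv => ?_
  obtain ⟨a, b, rfl⟩ := h v hv
  obtain ⟨hv0, μ, hμ, -⟩ := hv
  rw [Finset.mem_coe, Finset.mem_image]
  by_cases hb : b = 0
  · have ha : a ≠ 0 := by
      rintro rfl
      exact hv0 (by simp [hb])
    exact ⟨(Units.mk0 a ha, none), by simp [B], by simp [g, hb, Units.smul_def]⟩
  · refine ⟨(Units.mk0 b hb, some (b⁻¹ * a)), ?_, ?_⟩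
    · have hli : LinearIndependent F ![fun i => σ (u i), fun i => σ (w i)] := by
        have := huw.map_of_surjective_injective σ
          (σ.toRingHom.toAddMonoidHom.compLeft (Fin n)) σ.surjective
          (fun m hm => funext fun i => by simpa using congrFun hm i)
          (fun r m => by ext i; simp)
        convert this using 1
        ext i
        fin_cases i <;> rfl
      have hcomb : (a * α - μ * σ a) • (fun i => σ (u i)) +
          (b * β - μ * σ b) • (fun i => σ (w i)) = 0 := by
        have : (a • u + b • w) ᵥ* M = (a * α) • (fun i => σ (u i)) + (b * β) • (fun i => σ (w i)) := by
          rw [add_vecMul, smul_vecMul, smul_vecMul, hα, hβ, smul_smul, smul_smul]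
        rw [this] at hμ
        ext i
        have hi := congrFun hμ i
        simp at hi ⊢
        linear_combination hi
      obtain ⟨h1, h2⟩ := LinearIndependent.pair_iff.1 hli _ _ hcomb
      simp only [B, Finset.mem_product, Finset.mem_univ, true_and, Finset.some_mem_insertNone, T,
        Multiset.mem_toFinset, Polynomial.mem_roots hP, Polynomial.IsRoot.def]
      simp only [P, Polynomial.eval_sub, Polynomial.eval_mul, Polynomial.eval_C,
        Polynomial.eval_pow, Polynomial.eval_X]
      have hσb : σ b ≠ 0 := by simpa using hb
      have hba : (b⁻¹ * a) ^ s = (σ b)⁻¹ * σ a := by rw [← hσ, map_mul, map_inv₀]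
      rw [hba]
      field_simp
      have h3 : σ b * μ = b * β := by linear_combination -h2
      have : σ b * (b * σ a * β - σ b * (a * α)) = 0 := by
        linear_combination (-(σ b) ^ 2) * h1 + σ b * σ a * h2
      have h4 := (mul_eq_zero.1 this).resolve_left hσb
      linear_combination h4
    · simp only [g, Option.elim_some, Units.smul_def, Units.val_mk0, smul_add, smul_smul]
      rw [mul_inv_cancel_left₀ hb]

theorem two_mul_ncard_semiEigenSet_le {n : ℕ} (hq : Fintype.card F = s ^ 2) (hs : 2 ≤ s)
    (hσ : ∀ a : F, σ a = a ^ s) {M : Matrix (Fin n) (Fin n) F} {ν : F} (hν : ν ≠ 0)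
    (h : ∀ u ∈ semiEigenSet s σ M ν, ∀ v ∈ semiEigenSet s σ M ν, ∀ w ∈ semiEigenSet s σ M ν,
      ¬ LinearIndependent F ![u, v, w]) :
    2 * (semiEigenSet s σ M ν).ncard ≤ (Fintype.card F - 1) * ((s + 1) *
      Module.finrank F (Module.End.eigenspace (M * M.map σ).vecMulLinear ν)) := by
  have hsub := semiEigenSet_subset_eigenspace hq hσ M ν
  set E := Module.End.eigenspace (M * M.map σ).vecMulLinear ν
  by_cases hpair : ∃ u ∈ semiEigenSet s σ M ν, ∃ w ∈ semiEigenSet s σ M ν,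
      LinearIndependent F ![u, w]
  · obtain ⟨u, hu, w, hw, huw⟩ := hpair
    have h1 := ncard_semiEigenSet_le_of_span_pair hs hσ hν hu hw huw (by
      intro v hv
      have := h v hv u hu w hw
      have h3 : (![v, u, w] : Fin 3 → (Fin n → F)) = Fin.cons v ![u, w] := rfl
      rw [h3, linearIndependent_finCons, not_and, not_not, Matrix.range_cons, Matrix.range_cons,
        Matrix.range_empty, Set.union_empty] at this
      exact Submodule.mem_span_pair.1 (this huw))
    have h2 : 2 ≤ Module.finrank F E := by
      have hli : LinearIndependent F ![(⟨u, hsub hu⟩ : E), ⟨w, hsub hw⟩] := by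
        rw [LinearIndependent.pair_iff] at huw ⊢
        exact fun a b hab => huw a b (by simpa using congrArg Subtype.val hab)
      simpa using hli.fintype_card_le_finrank
    calc 2 * (semiEigenSet s σ M ν).ncard ≤ 2 * ((Fintype.card F - 1) * (s + 1)) := by gcongr
      _ = (Fintype.card F - 1) * ((s + 1) * 2) := by ring
      _ ≤ _ := by gcongr
  · push Not at hpair
    rcases (semiEigenSet s σ M ν).eq_empty_or_nonempty with he | ⟨u, hu⟩
    · simp [he]
    · have h1 : (semiEigenSet s σ M ν).ncard ≤ Fintype.card F - 1 := by
        refine ncard_smul_le (u := u) fun v hv => ⟨hv.1, ?_⟩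
        have := hpair u hu v hv
        rw [LinearIndependent.pair_iff' hu.1] at this
        push Not at this
        obtain ⟨a, ha⟩ := this
        exact ⟨a, ha.symm⟩
      have h2 : 1 ≤ Module.finrank F E := by
        have hli : LinearIndependent F ![(⟨u, hsub hu⟩ : E)] := by
          rw [linearIndependent_unique_iff]
          simpa using hu.1
        simpa using hli.fintype_card_le_finrank
      calc 2 * (semiEigenSet s σ M ν).ncard ≤ (Fintype.card F - 1) * 2 := by omega
        _ ≤ _ := by
          gcongr
          nlinarith

theorem two_mul_ncard_semiEigenSet_zero_le (hq : Fintype.card F = s ^ 2) (hs : 2 ≤ s)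
    (hσ : ∀ a : F, σ a = a ^ s) {M : Matrix (Fin 3) (Fin 3) F} (hM : M ≠ 0) :
    2 * (semiEigenSet s σ M 0).ncard ≤ (Fintype.card F - 1) * ((s + 1) *
      Module.finrank F (Module.End.eigenspace (M * M.map σ).vecMulLinear 0) +
        2 * (s ^ 2 - s)) := by
  set E := Module.End.eigenspace (M * M.map σ).vecMulLinear 0
  let L := LinearMap.ker M.vecMulLinear
  have hXL : insert 0 (semiEigenSet s σ M 0) ⊆ (L : Set (Fin 3 → F)) := by
    rintro v (rfl | ⟨-, μ, hμ, h0⟩)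
    · exact L.zero_mem
    · rw [pow_eq_zero_iff (by omega)] at h0
      simp [L, hμ, h0]
  have hcard : (semiEigenSet s σ M 0).ncard + 1 ≤ Fintype.card F ^ Module.finrank F L := by
    rw [← Set.ncard_insert_of_notMem (a := (0 : Fin 3 → F)) (by simp [semiEigenSet])]
    refine (Set.ncard_le_ncard hXL).trans (le_of_eq ?_)
    rw [← Nat.card_coe_set_eq, ← Nat.card_eq_fintype_card (α := F)]
    exact Module.natCard_eq_pow_finrank (K := F) (V := L)
  have hLE : Module.finrank F L ≤ Module.finrank F E := by
    refine Submodule.finrank_mono fun v hv => ?_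
    have hv' : v ᵥ* M = 0 := hv
    rw [Module.End.mem_eigenspace_iff, Matrix.vecMulLinear_apply, ← vecMul_vecMul, hv']
    simp
  have hL : Module.finrank F L < 3 := by
    have : L ≠ ⊤ := by
      intro ht
      apply hM
      ext i j
      have h0 : Pi.single i 1 ∈ L := ht ▸ Submodule.mem_top
      have h1 : Pi.single i 1 ᵥ* M = 0 := h0
      simpa using congrFun h1 j
    simpa using Submodule.finrank_lt this
  rw [hq] at *
  generalize Module.finrank F L = k at *
  generalize Module.finrank F E = e at *
  generalize (semiEigenSet s σ M 0).ncard = N at *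
  obtain ⟨r, rfl⟩ : ∃ r, s = r + 2 := ⟨s - 2, by omega⟩
  have e1 : (r + 2) ^ 2 - (r + 2) = (r + 1) * (r + 2) :=
    Nat.sub_eq_of_eq_add (by ring)
  have e2 : (r + 2) ^ 2 - 1 = (r + 1) * (r + 3) :=
    Nat.sub_eq_of_eq_add (by ring)
  rw [e1, e2]
  interval_cases k
  · have : N = 0 := by simpa using hcard
    simp [this]
  · rw [pow_one] at hcard
    have h1 : N ≤ (r + 1) * (r + 3) := by
      rw [← e2]
      omega
    calc 2 * N ≤ (r + 1) * (r + 3) * (2 : ℕ) := by omega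
      _ ≤ _ := by
        gcongr
        nlinarith [Nat.zero_le ((r + 1) * (r + 2))]
  · have h1 : N ≤ (r + 1) * (r + 3) * ((r + 2) ^ 2 + 1) := by
      have : ((r + 2) ^ 2) ^ 2 = (r + 1) * (r + 3) * ((r + 2) ^ 2 + 1) + 1 := by ring
      omega
    calc 2 * N ≤ (r + 1) * (r + 3) * (2 * ((r + 2) ^ 2 + 1)) := by linarith
      _ ≤ _ := by
        gcongr
        nlinarith

theorem exists_linearIndependent_semiEigenSet (hq : Fintype.card F = s ^ 2)
    (hσ : ∀ a : F, σ a = a ^ s) {M : Matrix (Fin 3) (Fin 3) F} (hM : M ≠ 0)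
    (h : (s + 1) * (s ^ 3 - 1) ≤ Nat.card {ξ : Fin 3 → F // ξ ≠ 0 ∧ IsSemiEigen σ M ξ}) :
    ∃ ν : F, ν ≠ 0 ∧ ∃ u ∈ semiEigenSet s σ M ν, ∃ v ∈ semiEigenSet s σ M ν,
      ∃ w ∈ semiEigenSet s σ M ν, LinearIndependent F ![u, v, w] := by
  classical
  by_contra! hno
  have h1 : 1 < Fintype.card F := Fintype.one_lt_card
  have hs : 2 ≤ s := by
    by_contra! h
    interval_cases s <;> omega
  let e : F → ℕ := fun ν => Module.finrank F (Module.End.eigenspace (M * M.map σ).vecMulLinear ν)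
  have he : ∑ ν, e ν ≤ 3 := by
    simpa using (Module.End.eigenspaces_iSupIndep
      (M * M.map σ).vecMulLinear).sum_finrank_le Finset.univ
  have hb (ν : F) : 2 * (semiEigenSet s σ M ν).ncard ≤ (Fintype.card F - 1) *
      ((s + 1) * e ν + if ν = 0 then 2 * (s ^ 2 - s) else 0) := by
    split_ifs with h0
    · subst h0
      exact two_mul_ncard_semiEigenSet_zero_le hq hs hσ hM
    · exact two_mul_ncard_semiEigenSet_le hq hs hσ h0 (hno ν h0)
  have hunion : Nat.card {ξ : Fin 3 → F // ξ ≠ 0 ∧ IsSemiEigen σ M ξ} ≤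
      ∑ ν, (semiEigenSet s σ M ν).ncard := by
    have hX (ν : F) : (semiEigenSet s σ M ν).ncard = (semiEigenSet s σ M ν).toFinset.card :=
      Set.ncard_eq_toFinset_card' _
    simp only [hX]
    refine le_trans ?_ Finset.card_biUnion_le
    rw [← Set.ncard_coe_finset]
    refine Set.ncard_le_ncard (s := {ξ : Fin 3 → F | ξ ≠ 0 ∧ IsSemiEigen σ M ξ}) ?_
    rintro ξ ⟨h0, μ, hμ⟩
    simp only [Finset.coe_biUnion, Set.mem_iUnion, Set.coe_toFinset]
    exact ⟨μ ^ (s + 1), Finset.mem_coe.2 (Finset.mem_univ _), h0, μ, hμ, rfl⟩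
  have hfin : 2 * ((s + 1) * (s ^ 3 - 1)) ≤
      (Fintype.card F - 1) * ((s + 1) * 3 + 2 * (s ^ 2 - s)) := by
    calc 2 * ((s + 1) * (s ^ 3 - 1)) ≤ 2 * ∑ ν, (semiEigenSet s σ M ν).ncard := by
          gcongr
          exact h.trans hunion
      _ ≤ ∑ ν, (Fintype.card F - 1) *
          ((s + 1) * e ν + if ν = 0 then 2 * (s ^ 2 - s) else 0) := by
          rw [Finset.mul_sum]
          exact Finset.sum_le_sum fun ν _ => hb ν
      _ = (Fintype.card F - 1) * ((s + 1) * ∑ ν, e ν + 2 * (s ^ 2 - s)) := by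
          rw [← Finset.mul_sum, Finset.sum_add_distrib, ← Finset.mul_sum]
          simp
      _ ≤ _ := by gcongr
  rw [hq] at hfin
  obtain ⟨r, rfl⟩ : ∃ r, s = r + 2 := ⟨s - 2, by omega⟩
  have e1 : (r + 2) ^ 2 - (r + 2) = (r + 1) * (r + 2) :=
    Nat.sub_eq_of_eq_add (by ring)
  have e2 : (r + 2) ^ 2 - 1 = (r + 1) * (r + 3) :=
    Nat.sub_eq_of_eq_add (by ring)
  have e3 : (r + 2) ^ 3 - 1 = (r + 1) * (r ^ 2 + 5 * r + 7) :=
    Nat.sub_eq_of_eq_add (by ring)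
  rw [e1, e2, e3] at hfin
  have hpos : 0 < (r + 1) * (r + 3) := by positivity
  have : 2 * (r ^ 2 + 5 * r + 7) ≤ (r + 2 + 1) * 3 + 2 * ((r + 1) * (r + 2)) := by
    refine le_of_mul_le_mul_left ?_ hpos
    calc _ = 2 * ((r + 2 + 1) * ((r + 1) * (r ^ 2 + 5 * r + 7))) := by ring
      _ ≤ _ := hfin
  nlinarith

end UpperBound

theorem IsCyclic.card_pow_eq_of_card_eq_mul {G : Type*} [CommGroup G] [IsCyclic G] [Finite G]
    {m n : ℕ} (h : Nat.card G = m * n) (c : G) [Decidable (c ^ n = 1)] :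
    Nat.card {t : G // t ^ m = c} = if c ^ n = 1 then m else 0 := by
  have hpos : 0 < m * n := h ▸ Nat.card_pos
  have hm : 0 < m := Nat.pos_of_mul_pos_right hpos
  have hn : 0 < n := Nat.pos_of_mul_pos_left hpos
  have hker : Nat.card (powMonoidHom m : G →* G).ker = m := by
    rw [IsCyclic.card_powMonoidHom_ker, h, Nat.gcd_mul_right_left]
  split_ifs with hc
  · have hle : (powMonoidHom m : G →* G).range ≤ (powMonoidHom n : G →* G).ker := by
      rintro _ ⟨t, rfl⟩
      simp [MonoidHom.mem_ker, ← pow_mul, ← h]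
    have heq : (powMonoidHom m : G →* G).range = (powMonoidHom n : G →* G).ker := by
      refine Subgroup.eq_of_le_of_card_ge hle (le_of_eq ?_)
      rw [IsCyclic.card_powMonoidHom_ker, IsCyclic.card_powMonoidHom_range, h,
        Nat.gcd_mul_right_left, Nat.gcd_mul_left_left, Nat.mul_div_cancel_left _ hm]
    obtain ⟨t₀, ht₀⟩ : c ∈ (powMonoidHom m : G →* G).range := heq ▸ hc
    rw [powMonoidHom_apply] at ht₀
    refine (Nat.card_congr ?_).trans hker
    refine (Equiv.mulRight t₀⁻¹).subtypeEquiv fun t => ?_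
    simp [MonoidHom.mem_ker, mul_pow, ht₀, mul_inv_eq_one]
  · rw [Nat.card_eq_zero]
    left
    refine ⟨fun ⟨t, ht⟩ => hc ?_⟩
    rw [← ht, ← pow_mul, ← h, pow_card_eq_one']

section Count

variable {F : Type*} [Field F] [Fintype F] {s : ℕ} {σ : F ≃+* F}

theorem card_units_eq_mul (hq : Fintype.card F = s ^ 2) : Nat.card Fˣ = (s - 1) * (s + 1) := by
  rw [Nat.card_units, Nat.card_eq_fintype_card, hq, mul_comm, ← Nat.sq_sub_sq, one_pow]

theorem card_mul_eq_mul_map [DecidableEq F] (hq : Fintype.card F = s ^ 2) (hs : 2 ≤ s)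
    (hσ : ∀ a : F, σ a = a ^ s) (α μ : Fˣ) :
    Nat.card {t : F // t * α = μ * σ t} = if α ^ (s + 1) = μ ^ (s + 1) then s else 1 := by
  classical
  have e : {t : F // t * α = μ * σ t} ≃ Option {t : Fˣ // t ^ (s - 1) = α / μ} := by
    refine Equiv.symm (Equiv.ofBijective
      (fun o => o.elim ⟨0, by simp⟩ fun t => ⟨(t.1 : F), ?_⟩) ⟨?_, ?_⟩)
    · obtain ⟨t, ht⟩ := t
      have h : t * α = μ * t ^ s := by
        rw [eq_div_iff_mul_eq'] at ht
        obtain ⟨r, rfl⟩ : ∃ r, s = r + 1 := ⟨s - 1, by omega⟩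
        rw [pow_succ, ← mul_assoc, ← ht, Nat.add_sub_cancel, mul_comm t, mul_comm μ]
      rw [hσ]
      exact_mod_cast congrArg Units.val h
    · rintro (_ | a) (_ | b) h
      · rfl
      · simp [eq_comm] at h
      · simp at h
      · simpa [Subtype.ext_iff, Units.ext_iff] using h
    · rintro ⟨t, ht⟩
      by_cases h0 : t = 0
      · exact ⟨none, by simp [h0]⟩
      · refine ⟨some ⟨Units.mk0 t h0, ?_⟩, by simp⟩
        rw [eq_div_iff_mul_eq']
        ext
        obtain ⟨r, rfl⟩ : ∃ r, s = r + 1 := ⟨s - 1, by omega⟩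
        rw [hσ] at ht
        simp only [Nat.add_sub_cancel, Units.val_mul, Units.val_pow_eq_pow_val, Units.val_mk0]
        apply mul_left_cancel₀ h0
        rw [ht]
        ring
  rw [Nat.card_congr e, Finite.card_option,
    IsCyclic.card_pow_eq_of_card_eq_mul (card_units_eq_mul hq), div_pow]
  simp only [div_eq_one]
  split_ifs <;> omega

theorem card_isSemiEigen_of_basis (hq : Fintype.card F = s ^ 2) (hs : 2 ≤ s)
    (hσ : ∀ a : F, σ a = a ^ s) {M : Matrix (Fin 3) (Fin 3) F}
    (b : Module.Basis (Fin 3) F (Fin 3 → F)) (α : Fin 3 → Fˣ)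
    (hb : ∀ i, b i ᵥ* M = (α i : F) • (fun j => σ (b i j)))
    {ν : Fˣ} (hα : ∀ i, α i ^ (s + 1) = ν) :
    Nat.card {ξ : Fin 3 → F // ξ ≠ 0 ∧ IsSemiEigen σ M ξ} = (s + 1) * (s ^ 3 - 1) := by
  classical
  let S : (Fin 3 → F) →+ (Fin 3 → F) := σ.toRingHom.toAddMonoidHom.compLeft (Fin 3)
  have hS (v : Fin 3 → F) : S v = fun i => σ (v i) := rfl
  have hSsmul (c : F) (v : Fin 3 → F) : S (c • v) = σ c • S v := by
    ext i
    simp [hS]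
  have hli : LinearIndependent F (S ∘ b) :=
    b.linearIndependent.map_of_surjective_injective σ S σ.surjective
      (fun m hm => funext fun i => by simpa [hS] using congrFun hm i) hSsmul
  have hiff (μ : F) (ξ : Fin 3 → F) : ξ ᵥ* M = μ • (fun i => σ (ξ i)) ↔
      ∀ i, b.equivFun ξ i * α i = μ * σ (b.equivFun ξ i) := by
    set a := b.equivFun ξ with ha
    have hξ : ξ = ∑ i, a i • b i := (b.sum_equivFun ξ).symm
    have h1 : ξ ᵥ* M = ∑ i, (a i * α i) • S (b i) := by
      rw [hξ, ← Matrix.vecMulLinear_apply, map_sum]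
      refine Finset.sum_congr rfl fun i _ => ?_
      rw [map_smul, Matrix.vecMulLinear_apply, hb, smul_smul, hS]
    have h2 : μ • (fun i => σ (ξ i)) = ∑ i, (μ * σ (a i)) • S (b i) := by
      rw [← hS, hξ, map_sum, Finset.smul_sum]
      refine Finset.sum_congr rfl fun i _ => ?_
      rw [hSsmul, smul_smul]
    rw [h1, h2]
    constructor
    · intro h i
      rw [← sub_eq_zero, ← Finset.sum_sub_distrib] at h
      simp only [← sub_smul] at h
      exact sub_eq_zero.1 (Fintype.linearIndependent_iff.1 hli _ h i)
    · exact fun h => Finset.sum_congr rfl fun i _ => by rw [h i]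
  have hfib (μ : Fˣ) : Nat.card {ξ : Fin 3 → F // ξ ≠ 0 ∧ ξ ᵥ* M = (μ : F) • (fun i => σ (ξ i))} =
      if μ ^ (s + 1) = ν then s ^ 3 - 1 else 0 := by
    have h1 : Nat.card {ξ : Fin 3 → F // ξ ᵥ* M = (μ : F) • (fun i => σ (ξ i))} =
        if μ ^ (s + 1) = ν then s ^ 3 else 1 := by
      have e : {ξ : Fin 3 → F // ξ ᵥ* M = (μ : F) • (fun i => σ (ξ i))} ≃
          ((i : Fin 3) → {t : F // t * α i = μ * σ t}) :=
        (b.equivFun.toEquiv.subtypeEquiv fun ξ => hiff μ ξ).trans Equiv.subtypePiEquivPi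
      rw [Nat.card_congr e, Nat.card_pi]
      simp only [card_mul_eq_mul_map hq hs hσ, hα, eq_comm (a := ν)]
      split_ifs <;> simp
    have h2 := Nat.card_subtype_and_not_add
      (fun ξ : Fin 3 → F => ξ ᵥ* M = (μ : F) • (fun i => σ (ξ i))) (fun ξ => ξ = 0)
    have h3 : Nat.card {ξ : Fin 3 → F // ξ ᵥ* M = (μ : F) • (fun i => σ (ξ i)) ∧ ξ = 0} = 1 := by
      rw [Nat.card_eq_one_iff_unique]
      exact ⟨⟨fun x y => Subtype.ext (x.2.2.trans y.2.2.symm)⟩, ⟨⟨0, by ext; simp, rfl⟩⟩⟩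
    rw [h1, h3] at h2
    simp only [and_comm (b := _ = _)]
    split_ifs at h2 ⊢ <;> simp only [ne_eq] <;> omega
  have e : {ξ : Fin 3 → F // ξ ≠ 0 ∧ IsSemiEigen σ M ξ} ≃
      Σ μ : Fˣ, {ξ : Fin 3 → F // ξ ≠ 0 ∧ ξ ᵥ* M = (μ : F) • (fun i => σ (ξ i))} := by
    refine Equiv.symm (Equiv.ofBijective (fun x => ⟨x.2.1, x.2.2.1, x.1, x.2.2.2⟩) ⟨?_, ?_⟩)
    · rintro ⟨μ, ξ, h0, hξ⟩ ⟨μ', ξ', h0', hξ'⟩ h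
      obtain rfl : ξ = ξ' := congrArg Subtype.val h
      have hne : (fun i => σ (ξ i)) ≠ 0 := fun h => h0 (funext fun i => by
        simpa using congrFun h i)
      obtain rfl : μ = μ' := Units.ext (smul_left_injective F hne (hξ.symm.trans hξ'))
      rfl
    · rintro ⟨ξ, h0, μ, hμ⟩
      have hμ0 : μ ≠ 0 := by
        rintro rfl
        apply h0
        apply b.equivFun.injective
        ext i
        simpa using (hiff 0 ξ).1 hμ i
      exact ⟨⟨Units.mk0 μ hμ0, ξ, h0, hμ⟩, rfl⟩
  have hν : Nat.card {μ : Fˣ // μ ^ (s + 1) = ν} = s + 1 := by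
    rw [IsCyclic.card_pow_eq_of_card_eq_mul ((card_units_eq_mul hq).trans (mul_comm _ _)),
      if_pos]
    rw [← hα 0, ← pow_mul, mul_comm, ← card_units_eq_mul hq, pow_card_eq_one']
  rw [Nat.card_congr e, Nat.card_sigma, Finset.sum_congr rfl fun μ _ => hfib μ,
    ← Finset.sum_filter, Finset.sum_const, smul_eq_mul, ← Fintype.card_subtype,
    ← Nat.card_eq_fintype_card, hν]

end Count

theorem stmt_12 (F : Type) [Field F] [Fintype F]
    (s : ℕ) (hq : Fintype.card F = s ^ 2)
    (σ : F ≃+* F) (hσ : ∀ a : F, σ a = a ^ s)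
    (M : Matrix (Fin (2 + 1)) (Fin (2 + 1)) F) (hM : M ≠ 0) :
    wt σ M = (Fintype.card F) ^ 3 - s ^ 3 ↔
      ∃ ξ₁ ξ₂ ξ₃ : Fin (2 + 1) → F, LinearIndependent F ![ξ₁, ξ₂, ξ₃] ∧
        ∃ α β γ : F, α ≠ 0 ∧ β ≠ 0 ∧ γ ≠ 0 ∧
          ξ₁ ᵥ* M = α • (fun i => σ (ξ₁ i)) ∧
          ξ₂ ᵥ* M = β • (fun i => σ (ξ₂ i)) ∧
          ξ₃ ᵥ* M = γ • (fun i => σ (ξ₃ i)) ∧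
          α ^ (s + 1) = β ^ (s + 1) ∧ β ^ (s + 1) = γ ^ (s + 1) := by
  have h1 : 1 < Fintype.card F := Fintype.one_lt_card
  have hs : 2 ≤ s := by
    by_contra! h
    interval_cases s <;> omega
  refine (wt_eq_iff_card_isSemiEigen hq σ M).trans ⟨fun h => ?_, ?_⟩
  · obtain ⟨ν, hν, u, ⟨-, α, hα, hαν⟩, v, ⟨-, β, hβ, hβν⟩, w, ⟨-, γ, hγ, hγν⟩, hli⟩ :=
      exists_linearIndependent_semiEigenSet hq hσ hM h.ge
    have hne {x : F} (hx : x ^ (s + 1) = ν) : x ≠ 0 := by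
      rintro rfl
      exact hν (by simp [← hx])
    exact ⟨u, v, w, hli, α, β, γ, hne hαν, hne hβν, hne hγν, hα, hβ, hγ,
      hαν.trans hβν.symm, hβν.trans hγν.symm⟩
  · rintro ⟨u, v, w, hli, α, β, γ, hα0, hβ0, hγ0, hα, hβ, hγ, hαβ, hβγ⟩
    let b : Module.Basis (Fin 3) F (Fin 3 → F) :=
      basisOfLinearIndependentOfCardEqFinrank hli (by simp)
    have hb : ⇑b = ![u, v, w] := coe_basisOfLinearIndependentOfCardEqFinrank _ _
    refine card_isSemiEigen_of_basis hq hs hσ b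
      ![Units.mk0 α hα0, Units.mk0 β hβ0, Units.mk0 γ hγ0] (fun i => ?_)
      (ν := Units.mk0 γ hγ0 ^ (s + 1)) (fun i => ?_)
    · rw [hb]
      fin_cases i
      · exact hα
      · exact hβ
      · exact hγ
    · ext
      fin_cases i
      · simpa using hαβ.trans hβγ
      · simpa using hβγ
      · simp
end

section
/- Let σ be a field automorphism of F_q with σ ≠ id, and suppose n > 2 or σ² ≠ id. A nonzero (n+1)×(n+1) matrix M over F_q satisfies wt(c_M) = q^{2n−1} − q^{n−1} (i.e. c_M is a minimum weight codeword of C(Λ_σ)) if and only if M has rank 1, say M = a·β with a a nonzero column vector and β a nonzero row vector, and β·a^σ ≠ 0 (i.e. the associated hyperplane of the point-hyperplane geometry is quasi-singular but not singular). -/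
open Matrix

/-- Counting nonzero vectors with a homogeneous property through their projective points. -/
lemma card_projectivization_rep_mul {F V : Type*} [Field F] [Finite F] [AddCommGroup V] [Module F V]
    (P : V → Prop) (hP : ∀ (c : F) (v : V), c ≠ 0 → (P (c • v) ↔ P v)) :
    Nat.card {p : Projectivization F V // P p.rep} * (Nat.card F - 1) =
      Nat.card {v : V // v ≠ 0 ∧ P v} := by
  classical
  rw [← Nat.card_units, ← Nat.card_prod]
  refine Nat.card_congr (Equiv.ofBijective
    (fun pu => ⟨(pu.2 : F) • pu.1.1.rep, smul_ne_zero pu.2.ne_zero pu.1.1.rep_nonzero,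
      (hP _ _ pu.2.ne_zero).2 pu.1.2⟩) ⟨?_, ?_⟩)
  · rintro ⟨⟨p, hp⟩, u⟩ ⟨⟨p', hp'⟩, u'⟩ h
    have h : (u : F) • p.rep = (u' : F) • p'.rep := congrArg Subtype.val h
    have hpp : p = p' := by
      rw [← p.mk_rep, ← p'.mk_rep, Projectivization.mk_eq_mk_iff']
      refine ⟨(u : F)⁻¹ * u', ?_⟩
      rw [mul_smul, ← h, smul_smul, inv_mul_cancel₀ u.ne_zero, one_smul]
    subst hpp
    have := smul_left_injective F p.rep_nonzero h
    simp [Units.ext_iff, this]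
  · rintro ⟨v, hv, hPv⟩
    obtain ⟨a, ha⟩ := Projectivization.exists_smul_eq_mk_rep F v hv
    refine ⟨⟨⟨Projectivization.mk F v hv, ?_⟩, a⁻¹⟩, ?_⟩
    · rw [← ha]; exact (hP _ _ a.ne_zero).2 hPv
    · apply Subtype.ext
      simp [← ha, Units.smul_def, smul_smul]

lemma card_eq_card_mul_card_ker {F W : Type*} [Field F] [Finite F] [AddCommGroup W] [Module F W]
    [Module.Finite F W] (φ : W →ₗ[F] F) (hφ : φ ≠ 0) :
    Nat.card W = Nat.card F * Nat.card (LinearMap.ker φ) := by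
  have h := LinearMap.finrank_range_add_finrank_ker φ
  rw [LinearMap.range_eq_top.2 (LinearMap.surjective hφ), finrank_top, Module.finrank_self] at h
  rw [Module.natCard_eq_pow_finrank (K := F) (V := W),
    Module.natCard_eq_pow_finrank (K := F) (V := LinearMap.ker φ), ← h, pow_add, pow_one]

lemma card_subtype_add_card_not {α : Type*} [Finite α] (P : α → Prop) :
    Nat.card {x // P x} + Nat.card {x // ¬ P x} = Nat.card α := by
  classical
  rw [← Nat.card_sum, Nat.card_congr (Equiv.sumCompl P)]

/-- The vectors orthogonal to `x` but not to `y`, for `y` outside the span of `x`. -/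
lemma card_dotProduct_eq_zero_and_ne_zero {F : Type*} [Field F] [Finite F] {m : ℕ}
    (x y : Fin (m + 2) → F) (hx : x ≠ 0) (hy : ∀ c : F, y ≠ c • x) :
    Nat.card {ξ : Fin (m + 2) → F // ξ ≠ 0 ∧ ξ ⬝ᵥ x = 0 ∧ ξ ⬝ᵥ y ≠ 0} =
      Nat.card F ^ m * (Nat.card F - 1) := by
  classical
  let φ (z : Fin (m + 2) → F) : (Fin (m + 2) → F) →ₗ[F] F := (dotProductBilin F F).flip z
  have hφ (z ξ) : φ z ξ = ξ ⬝ᵥ z := rfl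
  have h1 : φ x ≠ 0 := by
    intro h
    exact hx (dotProduct_eq_zero_iff.1 fun ξ => by
      rw [dotProduct_comm, ← hφ, h]; rfl)
  have h2 : (φ y).domRestrict (LinearMap.ker (φ x)) ≠ 0 := by
    intro h
    have hmem : y ∉ Submodule.span F {x} := by
      rw [Submodule.mem_span_singleton]
      rintro ⟨c, hc⟩
      exact hy c hc.symm
    obtain ⟨g, hg, hle⟩ := Submodule.exists_le_ker_of_notMem hmem
    have hgd (z) : g z = (fun i => g (Pi.single i 1)) ⬝ᵥ z := by
      conv_lhs => rw [pi_eq_sum_univ' z]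
      simp [dotProduct, mul_comm]
    have hgx : g x = 0 := hle (Submodule.mem_span_singleton_self x)
    apply hg
    rw [hgd] at hgx ⊢
    exact LinearMap.congr_fun h ⟨_, hgx⟩
  have e1 := card_eq_card_mul_card_ker _ h1
  have e2 := card_eq_card_mul_card_ker _ h2
  have e3 := card_subtype_add_card_not
    (fun ξ : LinearMap.ker (φ x) => (φ y).domRestrict (LinearMap.ker (φ x)) ξ = 0)
  have e4 : Nat.card {ξ : Fin (m + 2) → F // ξ ≠ 0 ∧ ξ ⬝ᵥ x = 0 ∧ ξ ⬝ᵥ y ≠ 0} =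
      Nat.card {ξ : LinearMap.ker (φ x) // ¬ (φ y).domRestrict (LinearMap.ker (φ x)) ξ = 0} := by
    refine Nat.card_congr
      ⟨fun ξ => ⟨⟨ξ.1, ξ.2.2.1⟩, ξ.2.2.2⟩, fun ξ => ⟨ξ.1.1, ?_, ξ.1.2, ξ.2⟩, fun _ => rfl,
        fun _ => rfl⟩
    intro h0
    apply ξ.2
    simp [h0]
  have hq : 0 < Nat.card F := Nat.card_pos
  have e5 : Nat.card {ξ : LinearMap.ker (φ x) //
      (φ y).domRestrict (LinearMap.ker (φ x)) ξ = 0} = Nat.card F ^ m := by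
    change Nat.card (LinearMap.ker ((φ y).domRestrict (LinearMap.ker (φ x)))) = _
    rw [Nat.card_fun, Nat.card_fin, e2] at e1
    have : Nat.card F ^ 2 * Nat.card F ^ m = Nat.card F ^ 2 *
      Nat.card (LinearMap.ker ((φ y).domRestrict (LinearMap.ker (φ x)))) := by
      rw [← pow_add, add_comm 2 m, e1]; ring
    exact (Nat.eq_of_mul_eq_mul_left (by positivity) this).symm
  have e6 : Nat.card (LinearMap.ker (φ x)) = Nat.card F ^ m * Nat.card F := by
    rw [e2, mul_comm, ← e5]; rfl
  rw [e4, Nat.mul_sub, mul_one]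
  omega

/-- The fibre over a point of the point-hyperplane pairs counted by `wt`. -/
lemma card_projectivization_dotProduct {F : Type*} [Field F] [Finite F] {m : ℕ}
    (x y : Fin (m + 2) → F) (hx : x ≠ 0) (hy : ∀ c : F, y ≠ c • x) :
    Nat.card {p : Projectivization F (Fin (m + 2) → F) // p.rep ⬝ᵥ x = 0 ∧ p.rep ⬝ᵥ y ≠ 0} =
      Nat.card F ^ m := by
  have h := card_projectivization_rep_mul (F := F)
    (fun ξ : Fin (m + 2) → F => ξ ⬝ᵥ x = 0 ∧ ξ ⬝ᵥ y ≠ 0) (by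
      intro c v hc
      simp [smul_dotProduct, hc])
  rw [card_dotProduct_eq_zero_and_ne_zero x y hx hy] at h
  have : 1 < Nat.card F := Finite.one_lt_card
  exact Nat.eq_of_mul_eq_mul_right (by omega) h

/-- The weight in terms of the number of vectors `x` with `M x^σ` proportional to `x`. -/
lemma wt_mul_add {F : Type} [Field F] [Fintype F] {m : ℕ} (σ : F ≃+* F)
    (M : Matrix (Fin (m + 1 + 1)) (Fin (m + 1 + 1)) F) :
    wt σ M * (Nat.card F - 1) + Nat.card F ^ m *
      Nat.card {x : Fin (m + 1 + 1) → F // ∃ c : F, M *ᵥ (fun i => σ (x i)) = c • x} =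
      Nat.card F ^ (2 * m + 2) := by
  classical
  let P : (Fin (m + 1 + 1) → F) → Prop := fun x => ∃ c : F, M *ᵥ (fun i => σ (x i)) = c • x
  have hwt : wt σ M = Nat.card F ^ m *
      Nat.card {p : Projectivization F (Fin (m + 1 + 1) → F) // ¬ P p.rep} := by
    have e : wt σ M = Nat.card (Σ p : {p : Projectivization F (Fin (m + 1 + 1) → F) // ¬ P p.rep},
        {l : Projectivization F (Fin (m + 1 + 1) → F) // l.rep ⬝ᵥ p.1.rep = 0 ∧
          l.rep ⬝ᵥ M *ᵥ (fun i => σ (p.1.rep i)) ≠ 0}) := by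
      refine Nat.card_congr ⟨fun pq => ⟨⟨pq.1.1, ?_⟩, ⟨pq.1.2, pq.2.1, ?_⟩⟩,
        fun s => ⟨(s.1.1, s.2.1), s.2.2.1, ?_⟩, fun _ => rfl, fun _ => rfl⟩
      · rintro ⟨c, hc⟩
        apply pq.2.2
        rw [← dotProduct_mulVec, hc, dotProduct_smul, pq.2.1, smul_zero]
      · rw [dotProduct_mulVec]; exact pq.2.2
      · rw [← dotProduct_mulVec]; exact s.2.2.2
    have : Fintype {p : Projectivization F (Fin (m + 1 + 1) → F) // ¬ P p.rep} :=
      Fintype.ofFinite _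
    rw [e, Nat.card_sigma, Finset.sum_congr rfl (fun p _ => card_projectivization_dotProduct
      p.1.rep _ p.1.rep_nonzero (fun c hc => p.2 ⟨c, hc⟩))]
    simp [mul_comm]
  have hP : ∀ (c : F) (v : Fin (m + 1 + 1) → F), c ≠ 0 → (¬ P (c • v) ↔ ¬ P v) := by
    intro c v hc
    have hs : M *ᵥ (fun i => σ ((c • v) i)) = σ c • (M *ᵥ (fun i => σ (v i))) := by
      rw [← mulVec_smul]; congr 1; ext i; simp
    have hc' : σ c ≠ 0 := by simpa using hc
    rw [not_iff_not]
    constructor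
    · rintro ⟨d, hd⟩
      refine ⟨(σ c)⁻¹ * (d * c), ?_⟩
      rw [hs] at hd
      rw [mul_smul, mul_smul, ← hd, smul_smul, inv_mul_cancel₀ hc', one_smul]
    · rintro ⟨d, hd⟩
      refine ⟨σ c * d * c⁻¹, ?_⟩
      rw [hs, hd, smul_smul, smul_smul, mul_assoc, inv_mul_cancel₀ hc, mul_one]
  have h0 : P 0 := ⟨0, by
    have : (fun i => σ ((0 : Fin (m + 1 + 1) → F) i)) = 0 := by ext i; simp
    rw [this]; simp⟩
  have h1 := card_projectivization_rep_mul (F := F) (fun x => ¬ P x) hP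
  have h2 : Nat.card {v : Fin (m + 1 + 1) → F // v ≠ 0 ∧ ¬ P v} =
      Nat.card {v : Fin (m + 1 + 1) → F // ¬ P v} := by
    refine Nat.card_congr (Equiv.subtypeEquivRight fun v => ?_)
    refine and_iff_right_of_imp ?_
    rintro hv rfl
    exact hv h0
  have h3 := card_subtype_add_card_not P
  rw [Nat.card_fun, Nat.card_fin] at h3
  rw [hwt, mul_assoc, h1, h2, ← mul_add, add_comm, h3, ← pow_add]
  congr 1
  ring

lemma wt_eq_iff {F : Type} [Field F] [Fintype F] {n : ℕ} (hn : 1 ≤ n) (σ : F ≃+* F)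
    (M : Matrix (Fin (n + 1)) (Fin (n + 1)) F) :
    wt σ M = (Fintype.card F) ^ (2 * n - 1) - (Fintype.card F) ^ (n - 1) ↔
      Nat.card {x : Fin (n + 1) → F // ∃ c : F, M *ᵥ (fun i => σ (x i)) = c • x} + 1 =
        Nat.card F ^ n + Nat.card F := by
  obtain ⟨m, rfl⟩ : ∃ m, n = m + 1 := ⟨n - 1, by omega⟩
  have h := wt_mul_add σ M
  rw [← Nat.card_eq_fintype_card, show 2 * (m + 1) - 1 = 2 * m + 1 by omega, Nat.add_sub_cancel]
  set t := Nat.card {x : Fin (m + 1 + 1) → F // ∃ c : F, M *ᵥ (fun i => σ (x i)) = c • x}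
  have hq : 1 < Nat.card F := Finite.one_lt_card
  generalize Nat.card F = q at *
  generalize wt σ M = w at *
  obtain ⟨k, rfl⟩ : ∃ k, q = k + 2 := ⟨q - 2, by omega⟩
  have hle : (k + 2) ^ m ≤ (k + 2) ^ (2 * m + 1) := Nat.pow_le_pow_right (by omega) (by omega)
  rw [show k + 2 - 1 = k + 1 by omega] at h
  have hp : 0 < (k + 2) ^ m := by positivity
  zify [hle] at h hp ⊢
  have e1 : ((k : ℤ) + 2) ^ (2 * m + 1) = ((k + 2) ^ m) ^ 2 * (k + 2) := by ring
  have e2 : ((k : ℤ) + 2) ^ (2 * m + 2) = ((k + 2) ^ m) ^ 2 * (k + 2) ^ 2 := by ring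
  have e3 : ((k : ℤ) + 2) ^ (m + 1) = ((k + 2) ^ m) * (k + 2) := by ring
  rw [e2] at h
  rw [e1, e3]
  generalize ((k : ℤ) + 2) ^ m = Q at *
  constructor
  · intro hw
    apply mul_left_cancel₀ hp.ne'
    linear_combination h - (k + 1) * hw
  · intro ht
    have hk : (k : ℤ) + 1 ≠ 0 := by positivity
    apply mul_left_cancel₀ hk
    linear_combination h - Q * ht

lemma card_twisted_eq_le {F : Type*} [Field F] [Finite F] (σ : F ≃+* F) {a : F} (ha : a ≠ 0)
    (b : F) : Nat.card {c : F // σ c * a = b * c} ≤ Nat.card {c : F // σ c = c} := by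
  by_cases h : ∃ c₀ : F, c₀ ≠ 0 ∧ σ c₀ * a = b * c₀
  · obtain ⟨c₀, h0, hc₀⟩ := h
    have hs : σ c₀ ≠ 0 := by simpa using h0
    refine Nat.card_le_card_of_injective (fun c => ⟨c.1 / c₀, ?_⟩) ?_
    · have hc := c.2
      rw [map_div₀, div_eq_div_iff hs h0]
      apply mul_right_cancel₀ ha
      linear_combination c₀ * hc - c.1 * hc₀
    · intro c d hcd
      have : c.1 / c₀ = d.1 / c₀ := congrArg Subtype.val hcd
      exact Subtype.ext ((div_left_inj' h0).1 this)
  · push Not at h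
    refine Nat.card_le_card_of_injective (fun _ => ⟨0, map_zero σ⟩) ?_
    intro c d _
    have key (e : {c : F // σ c * a = b * c}) : e.1 = 0 := by
      by_contra he
      exact h _ he e.2
    exact Subtype.ext ((key c).trans (key d).symm)

lemma card_twisted_eigenvectors_le {F : Type*} [Field F] [Finite F] (σ : F ≃+* F) :
    ∀ (k : ℕ) (l : Fin k → F), (∀ i, l i ≠ 0) →
      Nat.card {c : Fin k → F // ∃ μ : F, ∀ i, σ (c i) * l i = μ * c i} ≤
        1 + (Nat.card F - 1) * ∑ j ∈ Finset.range k, Nat.card {c : F // σ c = c} ^ j := by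
  intro k
  induction k with
  | zero =>
    intro l _
    simp
  | succ k ih =>
    intro l hl
    have ih := ih (fun i => l i.succ) (fun i => hl _)
    set q₀ := Nat.card {c : F // σ c = c}
    have hsplit := card_subtype_add_card_not
      (fun c : {c : Fin (k + 1) → F // ∃ μ : F, ∀ i, σ (c i) * l i = μ * c i} => c.1 0 = 0)
    have h1 : Nat.card {c : {c : Fin (k + 1) → F // ∃ μ : F, ∀ i, σ (c i) * l i = μ * c i} //
        c.1 0 = 0} ≤ Nat.card {c : Fin k → F // ∃ μ : F, ∀ i, σ (c i) * l i.succ = μ * c i} := by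
      refine Nat.card_le_card_of_injective (fun c => ⟨fun i => c.1.1 i.succ, ?_⟩) ?_
      · obtain ⟨μ, hμ⟩ := c.1.2
        exact ⟨μ, fun i => hμ i.succ⟩
      · intro c d hcd
        have hcd : (fun i : Fin k => c.1.1 i.succ) = fun i => d.1.1 i.succ :=
          congrArg Subtype.val hcd
        apply Subtype.ext
        apply Subtype.ext
        funext i
        refine Fin.cases ?_ (fun i => congrFun hcd i) i
        rw [c.2, d.2]
    have h2 : Nat.card {c : {c : Fin (k + 1) → F // ∃ μ : F, ∀ i, σ (c i) * l i = μ * c i} //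
        ¬ c.1 0 = 0} ≤ (Nat.card F - 1) * q₀ ^ k := by
      have : Fintype {a : F // a ≠ 0} := Fintype.ofFinite _
      calc _ ≤ Nat.card (Σ a : {a : F // a ≠ 0},
              ((i : Fin k) → {c : F // σ c * l i.succ = (σ a * l 0 / a) * c})) := by
            refine Nat.card_le_card_of_injective
              (fun c => ⟨⟨c.1.1 0, c.2⟩, fun i => ⟨c.1.1 i.succ, ?_⟩⟩) ?_
            · obtain ⟨μ, hμ⟩ := c.1.2
              rw [hμ i.succ, hμ 0, mul_div_cancel_right₀ _ c.2]
            · intro c d hcd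
              have h0 : c.1.1 0 = d.1.1 0 := congrArg (fun s => s.1.1) hcd
              apply Subtype.ext
              apply Subtype.ext
              funext i
              refine Fin.cases h0 (fun i => ?_) i
              exact congrArg (fun s => (s.2 i).1) hcd
        _ ≤ ∑ a : {a : F // a ≠ 0}, q₀ ^ k := by
            rw [Nat.card_sigma]
            refine Finset.sum_le_sum fun a _ => ?_
            rw [Nat.card_pi]
            calc _ ≤ ∏ i : Fin k, q₀ :=
                  Finset.prod_le_prod' fun i _ => card_twisted_eq_le σ (hl _) _
              _ = _ := by simp
        _ = (Nat.card F - 1) * q₀ ^ k := by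
            rw [Finset.sum_const, smul_eq_mul, Finset.card_univ, ← Nat.card_eq_fintype_card,
              ← Nat.card_congr unitsEquivNeZero, Nat.card_units]
    rw [Finset.sum_range_succ, mul_add]
    omega

lemma card_fixed_pow_le {F : Type*} [Field F] [Finite F] (σ : F ≃+* F)
    (hσ : σ ≠ RingEquiv.refl F) :
    Nat.card {c : F // σ c = c} ^ 2 ≤ Nat.card F ∧
      (σ.trans σ ≠ RingEquiv.refl F → Nat.card {c : F // σ c = c} ^ 3 ≤ Nat.card F) := by
  let K : Subfield F := (σ : F →+* F).eqLocusField (RingHom.id F)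
  have hK : Nat.card {c : F // σ c = c} = Nat.card K := rfl
  let τ : F ≃ₐ[K] F := AlgEquiv.ofRingEquiv (f := σ) (fun x => x.2)
  have hτ (x : F) : τ x = σ x := rfl
  have h1 : τ ≠ 1 := by
    intro h
    apply hσ
    ext x
    rw [← hτ, h]; rfl
  have hcard : Nat.card (F ≃ₐ[K] F) ≤ Module.finrank K F := by
    rw [Nat.card_eq_fintype_card]
    exact AlgEquiv.card_le
  have hord : orderOf τ ≤ Nat.card (F ≃ₐ[K] F) := orderOf_le_card
  have hpos : 0 < orderOf τ := orderOf_pos τ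
  have hne1 : orderOf τ ≠ 1 := by rwa [Ne, orderOf_eq_one_iff]
  have hKpos : 0 < Nat.card K := Nat.card_pos
  rw [hK, Module.natCard_eq_pow_finrank (K := K) (V := F)]
  refine ⟨Nat.pow_le_pow_right hKpos (by omega), fun h2 => Nat.pow_le_pow_right hKpos ?_⟩
  have hne2 : orderOf τ ≠ 2 := by
    intro h
    apply h2
    have := pow_orderOf_eq_one τ
    rw [h] at this
    ext x
    have := AlgEquiv.congr_fun this x
    rw [pow_two] at this
    exact this
  omega

lemma sum_pow_succ_lt_sum_pow {q q₀ n : ℕ} (hq₀ : 2 ≤ q₀) (hn : 2 ≤ n) (h2 : q₀ ^ 2 ≤ q)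
    (h3 : 2 < n ∨ q₀ ^ 3 ≤ q) :
    ∑ j ∈ Finset.range n, q₀ ^ (j + 1) < ∑ j ∈ Finset.range n, q ^ j := by
  have step (m : ℕ) (hm : 2 ≤ m)
      (h : ∑ j ∈ Finset.range m, q₀ ^ (j + 1) < ∑ j ∈ Finset.range m, q ^ j) :
      ∑ j ∈ Finset.range (m + 1), q₀ ^ (j + 1) < ∑ j ∈ Finset.range (m + 1), q ^ j := by
    rw [Finset.sum_range_succ, Finset.sum_range_succ]
    refine Nat.add_lt_add_of_lt_of_le h ?_
    calc q₀ ^ (m + 1) ≤ q₀ ^ (2 * m) := Nat.pow_le_pow_right (by omega) (by omega)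
      _ = (q₀ ^ 2) ^ m := by rw [pow_mul]
      _ ≤ q ^ m := Nat.pow_le_pow_left h2 m
  by_cases hc : q₀ ^ 3 ≤ q
  · induction n, hn using Nat.le_induction with
    | base =>
      simp only [Finset.sum_range_succ, Finset.sum_range_zero]
      have h4 : 2 * q₀ ≤ q₀ ^ 2 := by nlinarith
      have h5 : 2 * q₀ ^ 2 ≤ q₀ ^ 3 := by rw [pow_succ' q₀ 2]; gcongr
      simp only [zero_add, pow_zero, pow_one, Nat.reduceAdd]
      omega
    | succ m hm ih => exact step m hm (ih (Or.inr hc))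
  · have hn3 : 3 ≤ n := by omega
    clear h3 hn
    induction n, hn3 using Nat.le_induction with
    | base =>
      simp only [Finset.sum_range_succ, Finset.sum_range_zero]
      have : (q₀ ^ 2) ^ 2 ≤ q ^ 2 := Nat.pow_le_pow_left h2 2
      have h4 : 2 * q₀ ≤ q₀ ^ 2 := by nlinarith
      have h5 : 2 * q₀ ^ 2 ≤ q₀ ^ 3 := by rw [pow_succ' q₀ 2]; gcongr
      have h6 : 2 * q₀ ^ 3 ≤ (q₀ ^ 2) ^ 2 := by rw [← pow_mul, pow_succ' q₀ 3]; gcongr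
      simp only [zero_add, pow_zero, pow_one, Nat.reduceAdd]
      omega
    | succ m hm ih => exact step m (by omega) ih

lemma pow_add_mul_sum_lt {q q₀ n r : ℕ} (hq₀ : 2 ≤ q₀) (hn : 2 ≤ n) (h2 : q₀ ^ 2 ≤ q)
    (h3 : 2 < n ∨ q₀ ^ 3 ≤ q) (hr : 2 ≤ r) (hrn : r ≤ n + 1) :
    q ^ (n + 1 - r) + (q - 1) * ∑ j ∈ Finset.range r, q₀ ^ j < q ^ n + (q - 1) := by
  have hlt : q₀ < q := by nlinarith
  obtain ⟨s, rfl⟩ : ∃ s, r = s + 1 := ⟨r - 1, by omega⟩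
  obtain ⟨t, rfl⟩ : ∃ t, n = t + s := ⟨n - s, by omega⟩
  have hsum : ∑ j ∈ Finset.range s, q₀ ^ (j + 1) < ∑ j ∈ Finset.range s, q ^ (t + j) := by
    rcases Nat.eq_zero_or_pos t with rfl | ht
    · simp only [zero_add] at *
      exact sum_pow_succ_lt_sum_pow hq₀ hn h2 h3
    · refine Finset.sum_lt_sum_of_nonempty ⟨0, by simp; omega⟩ fun j _ => ?_
      calc q₀ ^ (j + 1) < q ^ (j + 1) := Nat.pow_lt_pow_left hlt (by omega)
        _ ≤ q ^ (t + j) := Nat.pow_le_pow_right (by omega) (by omega)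
  have hgeom : q ^ (t + s) = q ^ t + (q - 1) * ∑ j ∈ Finset.range s, q ^ (t + j) := by
    obtain ⟨p, rfl⟩ : ∃ p, q = p + 1 := ⟨q - 1, by omega⟩
    clear hsum hn h3 hr hrn
    induction s with
    | zero => simp
    | succ s ih =>
      rw [Finset.sum_range_succ, mul_add, ← add_assoc ((p + 1) ^ t), ← add_assoc t, ← ih,
        Nat.add_sub_cancel]
      ring
  rw [Finset.sum_range_succ', pow_zero, mul_add, mul_one, ← add_assoc, hgeom,
    show t + s + 1 - (s + 1) = t by omega]
  have := Nat.mul_lt_mul_of_pos_left hsum (show 0 < q - 1 by omega)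
  omega

lemma mulVec_map_smul {F ι : Type*} [Field F] [Fintype ι] (σ : F ≃+* F) (M : Matrix ι ι F)
    (c : F) (x : ι → F) :
    M *ᵥ (fun i => σ ((c • x) i)) = σ c • M *ᵥ (fun i => σ (x i)) := by
  rw [← mulVec_smul]; congr 1; ext i; simp

lemma card_mulVec_map_eq_zero {F ι : Type*} [Field F] [Finite F] [Fintype ι] (σ : F ≃+* F)
    (M : Matrix ι ι F) :
    Nat.card {x : ι → F // M *ᵥ (fun i => σ (x i)) = 0} =
      Nat.card F ^ (Fintype.card ι - M.rank) := by
  classical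
  have e : Nat.card {x : ι → F // M *ᵥ (fun i => σ (x i)) = 0} =
      Nat.card (LinearMap.ker M.mulVecLin) := by
    refine Nat.card_congr ((Equiv.arrowCongr (Equiv.refl ι) σ.toEquiv).subtypeEquiv fun x => ?_)
    rfl
  rw [e, Module.natCard_eq_pow_finrank (K := F)]
  have := LinearMap.finrank_range_add_finrank_ker M.mulVecLin
  rw [Module.finrank_fintype_fun_eq_card] at this
  congr 1
  rw [Matrix.rank]
  omega

/-- The number of eigenvectors with nonzero eigenvalue of the semilinear map `x ↦ M x^σ`. -/
lemma ncard_twisted_eigenvectors_le {F ι : Type*} [Field F] [Finite F] [Fintype ι] (σ : F ≃+* F)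
    (M : Matrix ι ι F) :
    {x : ι → F | ∃ c : F, c ≠ 0 ∧ M *ᵥ (fun i => σ (x i)) = c • x}.ncard ≤
      1 + (Nat.card F - 1) * ∑ j ∈ Finset.range M.rank, Nat.card {c : F // σ c = c} ^ j := by
  classical
  set E := {x : ι → F | ∃ c : F, c ≠ 0 ∧ M *ᵥ (fun i => σ (x i)) = c • x} with hE
  obtain ⟨v, hvE, hspan, hli⟩ := Submodule.exists_fun_fin_finrank_span_eq F E
  have hk : Module.finrank F (Submodule.span F E) ≤ M.rank := by
    refine Submodule.finrank_mono (Submodule.span_le.2 ?_)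
    rintro x ⟨c, hc, hx⟩
    refine ⟨c⁻¹ • fun i => σ (x i), ?_⟩
    rw [mulVecLin_apply, mulVec_smul, hx, smul_smul, inv_mul_cancel₀ hc, one_smul]
  generalize Module.finrank F (Submodule.span F E) = k at *
  choose l hl0 hl using hvE
  have hsub : E ⊆ (fun c : Fin k → F => ∑ i, c i • v i) ''
      {c | ∃ μ : F, ∀ i, σ (c i) * l i = μ * c i} := by
    intro x hx
    have hxs : x ∈ Submodule.span F (Set.range v) := hspan ▸ Submodule.subset_span hx
    obtain ⟨c, rfl⟩ := (Submodule.mem_span_range_iff_exists_fun F).1 hxs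
    obtain ⟨μ, _, hμ⟩ := hx
    refine ⟨c, ⟨μ, fun i => ?_⟩, rfl⟩
    have hf : M *ᵥ (fun j => σ ((∑ i, c i • v i) j)) = ∑ i, (σ (c i) * l i) • v i := by
      have : (fun j => σ ((∑ i, c i • v i) j)) = ∑ i, fun j => σ ((c i • v i) j) := by
        ext j; simp
      rw [this, mulVec_sum]
      exact Finset.sum_congr rfl fun i _ => by rw [mulVec_map_smul, hl, smul_smul]
    rw [hf, Finset.smul_sum] at hμ
    simp only [smul_smul] at hμ
    rw [← sub_eq_zero, ← Finset.sum_sub_distrib] at hμ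
    simp only [← sub_smul] at hμ
    exact sub_eq_zero.1 (Fintype.linearIndependent_iff.1 hli _ hμ i)
  calc E.ncard ≤ _ := Set.ncard_le_ncard hsub (Set.toFinite _)
    _ ≤ {c : Fin k → F | ∃ μ : F, ∀ i, σ (c i) * l i = μ * c i}.ncard :=
      Set.ncard_image_le (Set.toFinite _)
    _ ≤ _ := card_twisted_eigenvectors_le σ k l hl0
    _ ≤ _ := by
      gcongr

lemma card_mulVec_map_eq_smul_le {F ι : Type*} [Field F] [Finite F] [Fintype ι] (σ : F ≃+* F)
    (M : Matrix ι ι F) :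
    Nat.card {x : ι → F // ∃ c : F, M *ᵥ (fun i => σ (x i)) = c • x} ≤
      Nat.card F ^ (Fintype.card ι - M.rank) +
      (Nat.card F - 1) * ∑ j ∈ Finset.range M.rank, Nat.card {c : F // σ c = c} ^ j := by
  have hz : M *ᵥ (fun i : ι => σ ((0 : ι → F) i)) = 0 := by
    rw [show (fun i : ι => σ ((0 : ι → F) i)) = 0 by ext; simp, mulVec_zero]
  have hU : {x : ι → F | ∃ c : F, M *ᵥ (fun i => σ (x i)) = c • x} =
      {x | M *ᵥ (fun i => σ (x i)) = 0} ∪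
        {x | ∃ c : F, c ≠ 0 ∧ M *ᵥ (fun i => σ (x i)) = c • x} := by
    ext x
    constructor
    · rintro ⟨c, hc⟩
      by_cases h : c = 0
      · left; simpa [h] using hc
      · exact Or.inr ⟨c, h, hc⟩
    · rintro (h | ⟨c, _, hc⟩)
      · exact ⟨0, by simpa using h⟩
      · exact ⟨c, hc⟩
  have hI : 1 ≤ ({x : ι → F | M *ᵥ (fun i => σ (x i)) = 0} ∩
      {x | ∃ c : F, c ≠ 0 ∧ M *ᵥ (fun i => σ (x i)) = c • x}).ncard := by
    rw [Nat.one_le_iff_ne_zero, ← Nat.pos_iff_ne_zero, Set.ncard_pos (Set.toFinite _)]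
    exact ⟨0, hz, 1, one_ne_zero, by rw [hz, smul_zero]⟩
  have h := Set.ncard_union_add_ncard_inter {x : ι → F | M *ᵥ (fun i => σ (x i)) = 0}
    {x | ∃ c : F, c ≠ 0 ∧ M *ᵥ (fun i => σ (x i)) = c • x} (Set.toFinite _) (Set.toFinite _)
  rw [← hU] at h
  have hE := ncard_twisted_eigenvectors_le σ M
  have hK := card_mulVec_map_eq_zero σ M
  change Set.ncard {x : ι → F | M *ᵥ (fun i => σ (x i)) = 0} = _ at hK
  change Set.ncard {x : ι → F | ∃ c : F, M *ᵥ (fun i => σ (x i)) = c • x} ≤ _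
  omega

lemma exists_eq_vecMulVec_of_rank_le_one {F ι : Type*} [Field F] [Fintype ι] {M : Matrix ι ι F}
    (h : M.rank ≤ 1) : ∃ a β : ι → F, M = vecMulVec a β := by
  classical
  obtain ⟨⟨a, ha⟩, hv⟩ := finrank_le_one_iff.1 h
  choose β hβ using fun j => hv ⟨M *ᵥ Pi.single j 1, Pi.single j 1, rfl⟩
  refine ⟨a, β, ?_⟩
  ext i j
  have := congrFun (congrArg Subtype.val (hβ j)) i
  simp at this
  rw [vecMulVec_apply, mul_comm, this]

lemma card_dotProduct_map_eq_zero {F : Type*} [Field F] [Finite F] {n : ℕ} (σ : F ≃+* F)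
    {β : Fin (n + 1) → F} (hβ : β ≠ 0) :
    Nat.card {x : Fin (n + 1) → F // β ⬝ᵥ (fun i => σ (x i)) = 0} = Nat.card F ^ n := by
  let φ : (Fin (n + 1) → F) →ₗ[F] F := dotProductBilin F F β
  have hφ : φ ≠ 0 := fun h => hβ (dotProduct_eq_zero_iff.1 fun x => LinearMap.congr_fun h x)
  have e : Nat.card {x : Fin (n + 1) → F // β ⬝ᵥ (fun i => σ (x i)) = 0} =
      Nat.card (LinearMap.ker φ) :=
    Nat.card_congr
      ((Equiv.arrowCongr (Equiv.refl (Fin (n + 1))) σ.toEquiv).subtypeEquiv fun _ => Iff.rfl)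
  have h := card_eq_card_mul_card_ker φ hφ
  rw [Nat.card_fun, Nat.card_fin, pow_succ'] at h
  rw [e]
  exact (Nat.eq_of_mul_eq_mul_left Nat.card_pos h).symm

lemma vecMulVec_mulVec_map_eq_smul_iff {F ι : Type*} [Field F] [Fintype ι] (σ : F ≃+* F)
    {a β x : ι → F} (ha : a ≠ 0) :
    (∃ c : F, vecMulVec a β *ᵥ (fun i => σ (x i)) = c • x) ↔
      β ⬝ᵥ (fun i => σ (x i)) = 0 ∨ ∃ c : F, c • a = x := by
  have hm : vecMulVec a β *ᵥ (fun i => σ (x i)) = (β ⬝ᵥ fun i => σ (x i)) • a := by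
    rw [vecMulVec_mulVec, op_smul_eq_smul]
  rw [hm]
  constructor
  · rintro ⟨c, hc⟩
    by_cases h : c = 0
    · rw [h, zero_smul, smul_eq_zero] at hc
      exact Or.inl (hc.resolve_right ha)
    · refine Or.inr ⟨c⁻¹ * (β ⬝ᵥ fun i => σ (x i)), ?_⟩
      rw [mul_smul, hc, smul_smul, inv_mul_cancel₀ h, one_smul]
  · rintro (h | ⟨c, rfl⟩)
    · exact ⟨0, by rw [h, zero_smul, zero_smul]⟩
    · by_cases hc : c = 0
      · refine ⟨0, ?_⟩
        simp [hc, dotProduct]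
      · refine ⟨(β ⬝ᵥ fun i => σ ((c • a) i)) * c⁻¹, ?_⟩
        rw [smul_smul, mul_assoc, inv_mul_cancel₀ hc, mul_one]

lemma card_vecMulVec_of_ne_zero {F : Type*} [Field F] [Finite F] {n : ℕ} (σ : F ≃+* F)
    {a β : Fin (n + 1) → F} (h : β ⬝ᵥ (fun i => σ (a i)) ≠ 0) :
    Nat.card {x : Fin (n + 1) → F //
      ∃ c : F, vecMulVec a β *ᵥ (fun i => σ (x i)) = c • x} + 1 = Nat.card F ^ n + Nat.card F := by
  have ha : a ≠ 0 := by
    rintro rfl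
    exact h (by simp [dotProduct])
  have hβ : β ≠ 0 := by
    rintro rfl
    exact h (zero_dotProduct _)
  have hK := card_dotProduct_map_eq_zero σ hβ
  change Set.ncard {x : Fin (n + 1) → F | β ⬝ᵥ (fun i => σ (x i)) = 0} = _ at hK
  have hR : (Set.range fun c : F => c • a).ncard = Nat.card F := by
    rw [← Set.image_univ, Set.ncard_image_of_injective _ (smul_left_injective F ha),
      Set.ncard_univ]
  have hU : {x : Fin (n + 1) → F | ∃ c : F, vecMulVec a β *ᵥ (fun i => σ (x i)) = c • x} =
      {x | β ⬝ᵥ (fun i => σ (x i)) = 0} ∪ Set.range fun c : F => c • a := by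
    ext x
    exact vecMulVec_mulVec_map_eq_smul_iff σ ha
  have hI : {x | β ⬝ᵥ (fun i => σ (x i)) = 0} ∩ (Set.range fun c : F => c • a) = {0} := by
    ext x
    constructor
    · rintro ⟨hx, c, rfl⟩
      have hs : (fun i => σ ((c • a) i)) = σ c • fun i => σ (a i) := by ext i; simp
      change β ⬝ᵥ (fun i => σ ((c • a) i)) = 0 at hx
      rw [hs, dotProduct_smul, smul_eq_mul, mul_eq_zero, or_iff_left h] at hx
      have hc : c = 0 := by simpa using hx
      simp [hc]
    · rintro rfl
      exact ⟨by simp [dotProduct], 0, zero_smul F a⟩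
  have := Set.ncard_union_add_ncard_inter {x : Fin (n + 1) → F | β ⬝ᵥ (fun i => σ (x i)) = 0}
    (Set.range fun c : F => c • a) (Set.toFinite _) (Set.toFinite _)
  rw [← hU, hI, Set.ncard_singleton, hK, hR] at this
  exact this

lemma card_vecMulVec_of_eq_zero {F : Type*} [Field F] [Finite F] {n : ℕ} (σ : F ≃+* F)
    {a β : Fin (n + 1) → F} (ha : a ≠ 0) (hβ : β ≠ 0) (h : β ⬝ᵥ (fun i => σ (a i)) = 0) :
    Nat.card {x : Fin (n + 1) → F //
      ∃ c : F, vecMulVec a β *ᵥ (fun i => σ (x i)) = c • x} = Nat.card F ^ n := by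
  rw [← card_dotProduct_map_eq_zero σ hβ]
  refine Nat.card_congr (Equiv.subtypeEquivRight fun x => ?_)
  rw [vecMulVec_mulVec_map_eq_smul_iff σ ha, or_iff_left_of_imp]
  rintro ⟨c, rfl⟩
  have hs : (fun i => σ ((c • a) i)) = σ c • fun i => σ (a i) := by ext i; simp
  rw [hs, dotProduct_smul, h, smul_zero]

theorem stmt_13 (F : Type) [Field F] [Fintype F] (n : ℕ) (hn : 2 ≤ n)
    (σ : F ≃+* F) (hσ : σ ≠ RingEquiv.refl F)
    (hcase : 2 < n ∨ σ.trans σ ≠ RingEquiv.refl F)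
    (M : Matrix (Fin (n + 1)) (Fin (n + 1)) F) (hM : M ≠ 0) :
    wt σ M = (Fintype.card F) ^ (2 * n - 1) - (Fintype.card F) ^ (n - 1) ↔
      ∃ (a β : Fin (n + 1) → F), a ≠ 0 ∧ β ≠ 0 ∧ M = vecMulVec a β ∧
        β ⬝ᵥ (fun i => σ (a i)) ≠ 0 := by
  rw [wt_eq_iff (by omega)]
  have hq : 1 < Nat.card F := Finite.one_lt_card
  constructor
  · intro h
    have hr : M.rank ≤ 1 := by
      by_contra! hr
      have hq₀ : 2 ≤ Nat.card {c : F // σ c = c} := by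
        have : Nontrivial {c : F // σ c = c} :=
          ⟨⟨0, map_zero σ⟩, ⟨1, map_one σ⟩, fun h => zero_ne_one (congrArg Subtype.val h)⟩
        exact Finite.one_lt_card
      obtain ⟨h2, h3⟩ := card_fixed_pow_le σ hσ
      have hlt := pow_add_mul_sum_lt hq₀ hn h2 (hcase.imp_right h3) hr
        (by simpa using M.rank_le_card_width)
      have hle := card_mulVec_map_eq_smul_le σ M
      rw [Fintype.card_fin] at hle
      omega
    obtain ⟨a, β, rfl⟩ := exists_eq_vecMulVec_of_rank_le_one hr
    have ha : a ≠ 0 := by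
      rintro rfl
      exact hM (zero_vecMulVec β)
    have hβ : β ≠ 0 := by
      rintro rfl
      exact hM (vecMulVec_zero a)
    refine ⟨a, β, ha, hβ, rfl, fun h0 => ?_⟩
    rw [card_vecMulVec_of_eq_zero σ ha hβ h0] at h
    omega
  · rintro ⟨a, β, -, -, rfl, h⟩
    exact card_vecMulVec_of_ne_zero σ h
end
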